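/- arXiv:2101.09266 — 8 statements merged into one kernel-verified Lean document; each statement's English description precedes it below -/
import Mathlib

section
/- Let P be a real symmetric positive definite n×n matrix and let V be any real n×n matrix. Write V = Ṽ + V̂ where Ṽ = (V + Vᵀ)/2 is the symmetric part and V̂ = (V − Vᵀ)/2 is the antisymmetric part. Then: (1) tr(V·P·V·P) = tr(Ṽ·P·Ṽ·P) + tr(V̂·P·V̂·P); (2) if Ṽ ≠ 0 then tr(Ṽ·P·Ṽ·P) > 0; (3) if V̂ ≠ 0 then tr(V̂·P·V̂·P) < 0. -/
noncomputable section
open Matrix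

theorem trace_transpose_mul_mul_mul_pos {m : Type*} [Fintype m] [DecidableEq m]
    {P A : Matrix m m ℝ} (hP : P.PosDef) (hA : A ≠ 0) : 0 < trace (Aᵀ * P * A * P) := by
  open scoped MatrixOrder Matrix.Norms.L2Operator in
  obtain ⟨B, hB, rfl⟩ :=
    CStarAlgebra.isStrictlyPositive_iff_eq_star_mul_self.mp hP.isStrictlyPositive
  have hBt : IsUnit Bᵀ := by simpa [isUnit_transpose] using hB
  have hC : B * A * Bᵀ ≠ 0 := by
    rwa [Ne, hBt.mul_left_eq_zero, hB.mul_right_eq_zero]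
  have key : trace (Aᵀ * (star B * B) * A * (star B * B)) =
      trace ((B * A * Bᵀ)ᴴ * (B * A * Bᵀ)) := by
    simp only [star_eq_conjTranspose, conjTranspose_eq_transpose_of_trivial, transpose_mul,
      transpose_transpose, Matrix.mul_assoc]
    rw [trace_mul_comm B]
    simp only [Matrix.mul_assoc]
  rw [key]
  exact (posSemidef_conjTranspose_mul_self _).trace_nonneg.lt_of_ne'
    fun h ↦ hC (trace_conjTranspose_mul_self_eq_zero_iff.mp h)

theorem trace_mul_mul_mul_eq_zero {m R : Type*} [Fintype m] [CommRing R] [NoZeroDivisors R]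
    [CharZero R] {P S K : Matrix m m R} (hP : Pᵀ = P) (hS : Sᵀ = S) (hK : Kᵀ = -K) :
    trace (S * P * K * P) = 0 := by
  refine self_eq_neg.mp ?_
  calc trace (S * P * K * P) = trace (S * P * K * P)ᵀ := (trace_transpose _).symm
    _ = -trace (P * K * P * S) := by simp [transpose_mul, hP, hS, hK, Matrix.mul_assoc]
    _ = -trace (S * P * K * P) := by rw [trace_mul_comm (P * K * P)]; simp only [Matrix.mul_assoc]

/-- decomposition of `tr(VPVP)` into symmetric and antisymmetric parts,
with the symmetric contribution positive and antisymmetric contribution negative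
(for a symmetric positive definite `P`). -/
theorem statement_0 {n : ℕ} (P V : Matrix (Fin n) (Fin n) ℝ)
    (hPsymm : Pᵀ = P)
    (hPpos : ∀ x : Fin n → ℝ, x ≠ 0 → 0 < x ⬝ᵥ P.mulVec x)
    (Vsym Vanti : Matrix (Fin n) (Fin n) ℝ)
    (hVsym : Vsym = (2 : ℝ)⁻¹ • (V + Vᵀ))
    (hVanti : Vanti = (2 : ℝ)⁻¹ • (V - Vᵀ)) :
    (Matrix.trace (V * P * V * P) =
      Matrix.trace (Vsym * P * Vsym * P) + Matrix.trace (Vanti * P * Vanti * P)) ∧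
    (Vsym ≠ 0 → 0 < Matrix.trace (Vsym * P * Vsym * P)) ∧
    (Vanti ≠ 0 → Matrix.trace (Vanti * P * Vanti * P) < 0) := by
  have hS : Vsymᵀ = Vsym := by
    rw [hVsym, transpose_smul, transpose_add, transpose_transpose, add_comm]
  have hK : Vantiᵀ = -Vanti := by
    rw [hVanti, transpose_smul, transpose_sub, transpose_transpose, ← smul_neg, neg_sub]
  have hV : V = Vsym + Vanti := by
    rw [hVsym, hVanti]
    module
  have hP : P.PosDef := .of_dotProduct_mulVec_pos hPsymm fun x hx ↦ by simpa using hPpos x hx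
  refine ⟨?_, fun h ↦ ?_, fun h ↦ ?_⟩
  · have h₁ := trace_mul_mul_mul_eq_zero hPsymm hS hK
    have h₂ : trace (Vanti * P * Vsym * P) = 0 := by
      rw [← h₁, Matrix.mul_assoc, trace_mul_comm, ← Matrix.mul_assoc]
    rw [hV]
    simp only [Matrix.add_mul, Matrix.mul_add, trace_add, h₁, h₂]
    ring
  · simpa [hS] using trace_transpose_mul_mul_mul_pos hP h
  · simpa [hK] using trace_transpose_mul_mul_mul_pos hP h
end
end

section
/- Let n ≥ 3. There exist a sequence A_k ∈ SL(n) and sequences of tangent vectors X_k, Y_k at A_k (i.e. tr(A_k⁻¹·X_k) = tr(A_k⁻¹·Y_k) = 0) with ‖X_k‖²·‖Y_k‖² − ⟨X_k,Y_k⟩² ≠ 0, such that ‖A_k⁻¹‖ → ∞ and liminf_{k→∞} |K(X_k, Y_k; A_k)| / ‖A_k⁻¹‖² > 0. In particular the sectional curvature of SL(n) with the Hilbert–Schmidt metric is unbounded. -/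
noncomputable section
open Matrix Filter

/-- The Hilbert–Schmidt norm of a square real matrix. -/
def hsNorm {n : ℕ} (X : Matrix (Fin n) (Fin n) ℝ) : ℝ :=
  Real.sqrt (Matrix.trace (X * Xᵀ))

/-- The Hilbert–Schmidt inner product of two square real matrices. -/
def hsInner {n : ℕ} (X Y : Matrix (Fin n) (Fin n) ℝ) : ℝ :=
  Matrix.trace (X * Yᵀ)

/-- The sectional curvature of `SL(n)` with the Hilbert–Schmidt metric at `A`,
for the 2-plane spanned by tangent vectors `X, Y`. -/
def sectCurv {n : ℕ} (A X Y : Matrix (Fin n) (Fin n) ℝ) : ℝ :=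
  (Matrix.trace (A⁻¹ * Y * A⁻¹ * Y) * Matrix.trace (A⁻¹ * X * A⁻¹ * X) -
      Matrix.trace (A⁻¹ * X * A⁻¹ * Y) ^ 2) /
    (hsNorm A⁻¹ ^ 2 * (hsNorm X ^ 2 * hsNorm Y ^ 2 - hsInner X Y ^ 2))

theorem hsNorm_sq {n : ℕ} (X : Matrix (Fin n) (Fin n) ℝ) :
    hsNorm X ^ 2 = Matrix.trace (X * Xᵀ) := by
  refine Real.sq_sqrt ?_
  simp only [Matrix.trace, Matrix.diag, Matrix.mul_apply, Matrix.transpose_apply]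
  exact Finset.sum_nonneg fun i _ => Finset.sum_nonneg fun j _ => mul_self_nonneg _

theorem hsNorm_diagonal_sq {n : ℕ} (b : Fin n → ℝ) :
    hsNorm (diagonal b) ^ 2 = ∑ i, b i ^ 2 := by
  rw [hsNorm_sq]
  simp [sq]

theorem diagonal_mul_single_add {n : ℕ} {b : Fin n → ℝ} {i j : Fin n} {t : ℝ}
    (hi : b i = t) (hj : b j = t) (c d : ℝ) :
    diagonal b * (single i j c + single j i d) = t • (single i j c + single j i d) := by
  ext k l
  simp only [diagonal_mul, Matrix.smul_apply, Matrix.add_apply, single_apply, smul_eq_mul]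
  grind

theorem trace_single_add_mul {n : ℕ} {i j : Fin n} (hij : i ≠ j) (c d e f : ℝ) :
    Matrix.trace ((single i j c + single j i d) * (single i j e + single j i f)) =
      c * f + d * e := by
  simp [add_mul, mul_add, hij, hij.symm, add_comm]

theorem trace_single_add {n : ℕ} {i j : Fin n} (hij : i ≠ j) (c d : ℝ) :
    Matrix.trace (single i j c + single j i d) = 0 := by
  simp [hij, hij.symm]

theorem transpose_single_add {n : ℕ} (i j : Fin n) (c d : ℝ) :
    (single i j c + single j i d)ᵀ = single i j d + single j i c := by
  simp [add_comm]

/-- If the inverse of `A` is diagonal with the same entry `t` at `i` and `j`, the plane spanned by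
`Eᵢⱼ + Eⱼᵢ` and `Eᵢⱼ - Eⱼᵢ` has curvature `-t ^ 4 / ‖A⁻¹‖ ^ 2`. -/
theorem sectCurv_of_inv_eq_diagonal {n : ℕ} {A : Matrix (Fin n) (Fin n) ℝ} {b : Fin n → ℝ}
    {i j : Fin n} {t : ℝ} (hA : A⁻¹ = diagonal b) (hij : i ≠ j) (hi : b i = t) (hj : b j = t) :
    sectCurv A (single i j 1 + single j i 1) (single i j 1 + single j i (-1)) =
      -t ^ 4 / hsNorm A⁻¹ ^ 2 := by
  simp only [sectCurv, hsInner, hsNorm_sq (single i j _ + single j i _)]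
  simp only [hA, Matrix.mul_assoc, transpose_single_add, diagonal_mul_single_add hi hj,
    Matrix.mul_smul, Matrix.smul_mul, Matrix.trace_smul, trace_single_add_mul hij, smul_eq_mul]
  rw [← mul_div_mul_right (-t ^ 4) _ (four_ne_zero (α := ℝ))]
  congr 1 <;> ring

theorem exists_diagonal_vectors {n : ℕ} (hn : 3 ≤ n) {t : ℝ} (ht : 1 ≤ t) :
    ∃ a b : Fin n → ℝ, ∏ i, a i = 1 ∧ (∀ i, a i * b i = 1) ∧ (∀ i, 0 ≤ b i ∧ b i ≤ t) ∧
      b ⟨0, by omega⟩ = t ∧ b ⟨1, by omega⟩ = t := by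
  obtain ⟨m, rfl⟩ := Nat.exists_eq_add_of_le' hn
  have h0 : 0 < t := by linarith
  have h1 : (t ^ 2)⁻¹ ≤ t := (inv_le_one_of_one_le₀ (one_le_pow₀ ht)).trans ht
  refine ⟨Fin.cons t⁻¹ (Fin.cons t⁻¹ (Fin.cons (t ^ 2) fun _ => 1)),
    Fin.cons t (Fin.cons t (Fin.cons (t ^ 2)⁻¹ fun _ => 1)), ?_, ?_, ?_, rfl, rfl⟩
  · simp only [Fin.prod_univ_succ, Fin.cons_zero, Fin.cons_succ, Finset.prod_const_one]
    field_simp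
  · simp [Fin.forall_fin_succ, h0.ne']
  · simp only [Fin.forall_fin_succ, Fin.cons_zero, Fin.cons_succ]
    refine ⟨⟨h0.le, le_rfl⟩, ⟨h0.le, le_rfl⟩, ⟨by positivity, h1⟩, fun _ => ⟨zero_le_one, ht⟩⟩

/-- for `n ≥ 3`, the sectional curvature of `SL(n)` with the
Hilbert–Schmidt metric is unbounded: there are points `Aₖ` going to infinity and
2-planes at `Aₖ` whose curvature is comparable to `‖Aₖ⁻¹‖²`. -/
theorem statement_4 {n : ℕ} (hn : 3 ≤ n) :
    ∃ A X Y : ℕ → Matrix (Fin n) (Fin n) ℝ,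
      (∀ k, (A k).det = 1) ∧
      (∀ k, Matrix.trace ((A k)⁻¹ * X k) = 0) ∧
      (∀ k, Matrix.trace ((A k)⁻¹ * Y k) = 0) ∧
      (∀ k, hsNorm (X k) ^ 2 * hsNorm (Y k) ^ 2 - hsInner (X k) (Y k) ^ 2 ≠ 0) ∧
      Tendsto (fun k => hsNorm (A k)⁻¹) atTop atTop ∧
      0 < Filter.liminf
        (fun k => |sectCurv (A k) (X k) (Y k)| / hsNorm (A k)⁻¹ ^ 2) atTop := by
  have ht : ∀ k : ℕ, (1 : ℝ) ≤ k + 1 := fun k => by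
    have := Nat.cast_nonneg (α := ℝ) k
    linarith
  choose a b hprod hab hb hb0 hb1 using fun k : ℕ => exists_diagonal_vectors hn (ht k)
  have hinv : ∀ k, (diagonal (a k))⁻¹ = diagonal (b k) := fun k => by
    refine Matrix.inv_eq_right_inv ?_
    rw [diagonal_mul_diagonal, ← diagonal_one]
    exact congrArg diagonal (funext (hab k))
  have hij : (⟨0, by omega⟩ : Fin n) ≠ ⟨1, by omega⟩ := by simp
  have hlow : ∀ k : ℕ, ((k : ℝ) + 1) ^ 2 ≤ hsNorm (diagonal (a k))⁻¹ ^ 2 := fun k => by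
    rw [hinv, hsNorm_diagonal_sq]
    refine (congrArg (· ^ 2) (hb0 k)).symm.le.trans ?_
    exact Finset.single_le_sum (f := fun i => b k i ^ 2) (fun i _ => sq_nonneg _)
      (Finset.mem_univ _)
  have hupp : ∀ k : ℕ, hsNorm (diagonal (a k))⁻¹ ^ 2 ≤ n * ((k : ℝ) + 1) ^ 2 := fun k => by
    rw [hinv, hsNorm_diagonal_sq]
    refine (Finset.sum_le_card_nsmul _ _ (((k : ℝ) + 1) ^ 2) fun i _ => ?_).trans_eq (by simp)
    exact pow_le_pow_left₀ (hb k i).1 (hb k i).2 2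
  have hratio : ∀ k : ℕ, |sectCurv (diagonal (a k))
      (single ⟨0, by omega⟩ ⟨1, by omega⟩ 1 + single ⟨1, by omega⟩ ⟨0, by omega⟩ 1)
      (single ⟨0, by omega⟩ ⟨1, by omega⟩ 1 + single ⟨1, by omega⟩ ⟨0, by omega⟩ (-1))| /
        hsNorm (diagonal (a k))⁻¹ ^ 2 =
      (((k : ℝ) + 1) ^ 2 / hsNorm (diagonal (a k))⁻¹ ^ 2) ^ 2 := fun k => by
    rw [sectCurv_of_inv_eq_diagonal (hinv k) hij (hb0 k) (hb1 k), neg_div, abs_neg,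
      abs_of_nonneg (by positivity)]
    ring
  have hn0 : (0 : ℝ) < n := by exact_mod_cast (by omega : 0 < n)
  refine ⟨fun k => diagonal (a k),
    fun _ => single ⟨0, by omega⟩ ⟨1, by omega⟩ 1 + single ⟨1, by omega⟩ ⟨0, by omega⟩ 1,
    fun _ => single ⟨0, by omega⟩ ⟨1, by omega⟩ 1 + single ⟨1, by omega⟩ ⟨0, by omega⟩ (-1),
    fun k => by rw [det_diagonal, hprod], fun k => ?_, fun k => ?_, fun k => ?_, ?_, ?_⟩
  · rw [hinv, diagonal_mul_single_add (hb0 k) (hb1 k), trace_smul, trace_single_add hij, smul_zero]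
  · rw [hinv, diagonal_mul_single_add (hb0 k) (hb1 k), trace_smul, trace_single_add hij, smul_zero]
  · rw [hsNorm_sq, hsNorm_sq, hsInner, transpose_single_add, transpose_single_add,
      trace_single_add_mul hij, trace_single_add_mul hij, trace_single_add_mul hij]
    norm_num
  · refine tendsto_atTop_mono (fun k => ?_) tendsto_natCast_atTop_atTop
    have := abs_le_of_sq_le_sq (hlow k) (Real.sqrt_nonneg _)
    linarith [le_abs_self ((k : ℝ) + 1)]
  · simp only [hratio]
    have hpos : ∀ k : ℕ, 0 < hsNorm (diagonal (a k))⁻¹ ^ 2 := fun k =>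
      lt_of_lt_of_le (by positivity) (hlow k)
    refine lt_of_lt_of_le (show (0 : ℝ) < (1 / n) ^ 2 by positivity) (le_liminf_of_le ?_ ?_)
    · refine IsBoundedUnder.isCoboundedUnder_ge
        (isBoundedUnder_of ⟨1, fun k => pow_le_one₀ (by positivity) ?_⟩)
      exact (div_le_one (hpos k)).2 (hlow k)
    · refine Eventually.of_forall fun k => pow_le_pow_left₀ (by positivity) ?_ 2
      rw [div_le_div_iff₀ hn0 (hpos k), one_mul, mul_comm]
      exact hupp k
end
end

section
/- Let A be a geodesic of SL(n) with the Hilbert–Schmidt metric. Then for all t ≥ 0, ‖A(t)‖ ≤ ‖A(0)‖ + t·‖A'(0)‖, where ‖·‖ is the Hilbert–Schmidt norm. -/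
noncomputable section
open Matrix Filter

attribute [local instance] Matrix.normedAddCommGroup Matrix.normedSpace

/-- A geodesic of `SL(n)` with the Hilbert–Schmidt metric: a twice differentiable
curve of determinant-one matrices satisfying the geodesic equation. -/
def IsGeodesic {n : ℕ} (A : ℝ → Matrix (Fin n) (Fin n) ℝ) : Prop :=
  (∀ t, DifferentiableAt ℝ A t) ∧ (∀ t, DifferentiableAt ℝ (deriv A) t) ∧
  (∀ t, (A t).det = 1) ∧
  (∀ t, deriv (deriv A) t =
    (Matrix.trace (deriv A t * (A t)⁻¹ * deriv A t * (A t)⁻¹) /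
      Matrix.trace ((A t)⁻¹ * ((A t)⁻¹)ᵀ)) • ((A t)⁻¹)ᵀ)

/-- Jacobi's formula, for the derivative of the determinant along a curve of matrices. -/
theorem hasDerivAt_det {n : ℕ} {A : ℝ → Matrix (Fin n) (Fin n) ℝ}
    {A' : Matrix (Fin n) (Fin n) ℝ} {t : ℝ} (hA : HasDerivAt A A' t) :
    HasDerivAt (fun s => (A s).det) (trace (A' * adjugate (A t))) t := by
  let D : ContinuousMultilinearMap ℝ (fun _ : Fin n => Fin n → ℝ) ℝ :=
    { (detRowAlternating : (Fin n → ℝ) [⋀^Fin n]→ₗ[ℝ] ℝ).toMultilinearMap with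
      cont := Continuous.matrix_det continuous_id }
  have h : HasDerivAt (fun s => D (A s)) (D.linearDeriv (A t) A') t :=
    (D.hasFDerivAt (A t)).comp_hasDerivAt t hA
  suffices e : trace (A' * adjugate (A t)) = D.linearDeriv (A t) A' from e ▸ h
  refine Eq.trans ?_ (D.linearDeriv_apply (A t) A').symm
  refine Finset.sum_congr rfl fun i _ => ?_
  change _ = ((A t).updateRow i (A' i)).det
  rw [← cramer_transpose_apply, cramer_eq_adjugate_mulVec, ← adjugate_transpose,
    mulVec_transpose]
  rfl

/-- A matrix regarded as a vector of Euclidean space, through its entries. -/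
def toEuclideanVec (n : ℕ) :
    Matrix (Fin n) (Fin n) ℝ →L[ℝ] EuclideanSpace ℝ (Fin n × Fin n) :=
  LinearMap.toContinuousLinearMap
    { toFun := fun X => WithLp.toLp 2 fun p => X p.1 p.2
      map_add' := fun _ _ => rfl
      map_smul' := fun _ _ => rfl }

theorem toEuclideanVec_apply {n : ℕ} (X : Matrix (Fin n) (Fin n) ℝ) (p : Fin n × Fin n) :
    toEuclideanVec n X p = X p.1 p.2 :=
  rfl

theorem hasDerivAt_toEuclideanVec {n : ℕ} {A : ℝ → Matrix (Fin n) (Fin n) ℝ}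
    {A' : Matrix (Fin n) (Fin n) ℝ} {t : ℝ} (hA : HasDerivAt A A' t) :
    HasDerivAt (fun s => toEuclideanVec n (A s)) (toEuclideanVec n A') t :=
  (toEuclideanVec n).hasFDerivAt.comp_hasDerivAt t hA

theorem inner_toEuclideanVec {n : ℕ} (X Y : Matrix (Fin n) (Fin n) ℝ) :
    inner ℝ (toEuclideanVec n X) (toEuclideanVec n Y) = trace (X * Yᵀ) := by
  simp [toEuclideanVec_apply, PiLp.inner_apply, Fintype.sum_prod_type, trace, mul_apply, mul_comm]

theorem hsNorm_eq_norm_toEuclideanVec {n : ℕ} (X : Matrix (Fin n) (Fin n) ℝ) :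
    hsNorm X = ‖toEuclideanVec n X‖ := by
  rw [hsNorm, ← inner_toEuclideanVec, real_inner_self_eq_norm_sq, Real.sqrt_sq (norm_nonneg _)]

theorem IsGeodesic.trace_deriv_mul_inv {n : ℕ} {A : ℝ → Matrix (Fin n) (Fin n) ℝ}
    (hA : IsGeodesic A) (t : ℝ) : trace (deriv A t * (A t)⁻¹) = 0 := by
  obtain ⟨h1, -, hdet, -⟩ := hA
  have h := hasDerivAt_det (h1 t).hasDerivAt
  simp only [hdet] at h
  rw [inv_def, hdet, Ring.inverse_one, one_smul]
  exact h.unique (hasDerivAt_const t 1)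

/-- Geodesics have constant speed. -/
theorem IsGeodesic.hsNorm_deriv_eq {n : ℕ} {A : ℝ → Matrix (Fin n) (Fin n) ℝ}
    (hA : IsGeodesic A) (s t : ℝ) : hsNorm (deriv A s) = hsNorm (deriv A t) := by
  have hd (r : ℝ) : HasDerivAt (fun r => ‖toEuclideanVec n (deriv A r)‖ ^ 2) 0 r := by
    have h := (hasDerivAt_toEuclideanVec
      ((hA.2.1 r).hasDerivAt.congr_deriv (hA.2.2.2 r))).norm_sq
    rwa [inner_toEuclideanVec, transpose_smul,
      transpose_transpose, Matrix.mul_smul, trace_smul, hA.trace_deriv_mul_inv, smul_zero,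
      mul_zero] at h
  have h := is_const_of_deriv_eq_zero (fun r => (hd r).differentiableAt)
    (fun r => (hd r).deriv) s t
  simpa only [hsNorm_eq_norm_toEuclideanVec] using
    (sq_eq_sq₀ (norm_nonneg _) (norm_nonneg _)).1 h

/-- along a geodesic of `SL(n)` with the Hilbert–Schmidt metric,
`‖A(t)‖ ≤ ‖A(0)‖ + t‖A'(0)‖` for all `t ≥ 0`. -/
theorem statement_5 {n : ℕ} (A : ℝ → Matrix (Fin n) (Fin n) ℝ) (hA : IsGeodesic A) :
    ∀ t : ℝ, 0 ≤ t → hsNorm (A t) ≤ hsNorm (A 0) + t * hsNorm (deriv A 0) := by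
  intro t ht
  have h := norm_image_sub_le_of_norm_deriv_le_segment' (a := 0) (b := t)
    (f := fun s => toEuclideanVec n (A s)) (f' := fun s => toEuclideanVec n (deriv A s))
    (C := hsNorm (deriv A 0))
    (fun s _ => (hasDerivAt_toEuclideanVec (hA.1 s).hasDerivAt).hasDerivWithinAt)
    (fun s _ => by rw [← hsNorm_eq_norm_toEuclideanVec, hA.hsNorm_deriv_eq s 0])
    t (Set.right_mem_Icc.2 ht)
  rw [sub_zero, mul_comm] at h
  rw [hsNorm_eq_norm_toEuclideanVec (A t), hsNorm_eq_norm_toEuclideanVec (A 0)]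
  linarith [norm_sub_norm_le (toEuclideanVec n (A t)) (toEuclideanVec n (A 0))]
end
end

section
/- SL(n) with the Hilbert–Schmidt metric is geodesically complete: for every A₀ ∈ M_n(ℝ) with det A₀ = 1 and every A₁ ∈ M_n(ℝ) with tr(A₀⁻¹·A₁) = 0, there exists a twice continuously differentiable curve A : ℝ → M_n(ℝ), defined for all t ∈ ℝ, with A(0) = A₀, A'(0) = A₁, det(A(t)) = 1 for all t, and satisfying the geodesic equation A''(t) = (tr(A'(t)·A(t)⁻¹·A'(t)·A(t)⁻¹) / tr(A(t)⁻¹·(A(t)⁻¹)ᵀ)) · (A(t)⁻¹)ᵀ for all t ∈ ℝ. -/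
noncomputable section
open Matrix Filter

attribute [local instance] Matrix.normedAddCommGroup Matrix.normedSpace

section GeodesicCompleteness

open Set Metric NNReal
open scoped Topology Manifold ContDiff

theorem exists_hasDerivAt_Ioo_of_lipschitzWith {E : Type*} [NormedAddCommGroup E]
    [NormedSpace ℝ E] [CompleteSpace E] {F : E → E} {K L : ℝ≥0} (hF : LipschitzWith K F)
    (hL : ∀ x, ‖F x‖ ≤ L) (x₀ : E) {a : ℝ} (ha : 0 < a) :
    ∃ γ : ℝ → E, γ 0 = x₀ ∧ ∀ t ∈ Ioo (-a) a, HasDerivAt γ (F (γ t)) t := by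
  have h0 : (0 : ℝ) ∈ Icc (-a) a := ⟨by linarith, ha.le⟩
  have hPL : IsPicardLindelof (fun _ ↦ F) (⟨0, h0⟩ : Icc (-a) a) x₀ (L * a.toNNReal) 0 L K :=
    { lipschitzOnWith := fun _ _ ↦ hF.lipschitzOnWith
      continuousOn := fun _ _ ↦ continuousOn_const
      norm_le := fun _ _ x _ ↦ hL x
      mul_max_le := by simp [ha.le] }
  obtain ⟨γ, hγ0, hγ⟩ := hPL.exists_eq_forall_mem_Icc_hasDerivWithinAt₀
  exact ⟨γ, hγ0, fun t ht ↦
    (hγ t (Ioo_subset_Icc_self ht)).hasDerivAt (Icc_mem_nhds ht.1 ht.2)⟩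

/-- A global integral curve of a `C¹` vector field `F` exists through `x₀` as soon as, on every
bounded time interval, the curves through `x₀` whose velocity is `F` damped by a factor of absolute
value at most one obey a common bound. -/
theorem exists_isIntegralCurve_of_bounded {E : Type*} [NormedAddCommGroup E] [NormedSpace ℝ E]
    [FiniteDimensional ℝ E] {F : E → E} (hF : ContDiff ℝ 1 F) (x₀ : E)
    (hbdd : ∀ a > 0, ∃ R : ℝ, ∀ (γ : ℝ → E) (c : ℝ → ℝ), γ 0 = x₀ → ContinuousOn c (Ioo (-a) a) →
      (∀ t, |c t| ≤ 1) → (∀ t ∈ Ioo (-a) a, HasDerivAt γ (c t • F (γ t)) t) →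
      ∀ t ∈ Ioo (-a) a, ‖γ t‖ ≤ R) :
    ∃ γ : ℝ → E, γ 0 = x₀ ∧ ∀ t, HasDerivAt γ (F (γ t)) t := by
  have := FiniteDimensional.complete ℝ E
  have key : ∀ a : ℝ, ∃ γ : ℝ → E, γ 0 = x₀ ∧
      IsMIntegralCurveOn (I := 𝓘(ℝ, E)) γ F (Ioo (-a) a) := by
    intro a
    rcases le_or_gt a 0 with ha | ha
    · refine ⟨fun _ ↦ x₀, rfl, ?_⟩
      rw [Ioo_eq_empty (by linarith)]
      intro t ht
      exact ht.elim
    obtain ⟨R, hR⟩ := hbdd a ha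
    let χ : ContDiffBump (0 : E) := ⟨max R 1, max R 1 + 1, by positivity, by linarith⟩
    have hsmooth : ContDiff ℝ 1 (fun x ↦ χ x • F x) := χ.contDiff.smul hF
    have hsupp : HasCompactSupport (fun x ↦ χ x • F x) := χ.hasCompactSupport.smul_right
    obtain ⟨K, hK⟩ := hsmooth.lipschitzWith_of_hasCompactSupport hsupp one_ne_zero
    obtain ⟨L, hL⟩ := hsupp.exists_bound_of_continuous hsmooth.continuous
    obtain ⟨γ, hγ0, hγ⟩ := exists_hasDerivAt_Ioo_of_lipschitzWith (L := L.toNNReal) hK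
      (fun x ↦ (hL x).trans (Real.le_coe_toNNReal L)) x₀ ha
    have hγR := hR γ (fun t ↦ χ (γ t)) hγ0
      (χ.continuous.comp_continuousOn fun t ht ↦ (hγ t ht).continuousAt.continuousWithinAt)
      (fun t ↦ abs_le.2 ⟨by linarith [χ.nonneg (x := γ t)], χ.le_one⟩) hγ
    refine ⟨γ, hγ0, fun t ht ↦ ?_⟩
    have h1 : χ (γ t) = 1 := 
      χ.one_of_mem_closedBall (mem_closedBall_zero_iff.2 ((hγR t ht).trans (le_max_left R 1)))
    have h2 := hγ t ht
    rw [h1, one_smul] at h2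
    exact h2.hasFDerivAt.hasMFDerivAt.hasMFDerivWithinAt
  obtain ⟨γ, hγ0, hγ⟩ := (exists_isMIntegralCurve_iff_exists_isMIntegralCurveOn_Ioo
    (contMDiff_vectorSpace_iff_contDiff.2 hF) x₀).2 key
  refine ⟨γ, hγ0, fun t ↦ ?_⟩
  have h : HasFDerivAt γ (ContinuousLinearMap.smulRight (1 : ℝ →L[ℝ] ℝ) (F (γ t))) t :=
    hasMFDerivAt_iff_hasFDerivAt.1 (hγ t)
  simpa using h.hasDerivAt

/-- Solutions of `φ' = c ψ`, `ψ' = d φ` with zero initial data vanish. -/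
theorem eq_zero_of_hasDerivAt_mul {a : ℝ} {c d φ ψ : ℝ → ℝ}
    (hc : ContinuousOn c (Ioo (-a) a)) (hd : ContinuousOn d (Ioo (-a) a))
    (hφ : ∀ t ∈ Ioo (-a) a, HasDerivAt φ (c t * ψ t) t)
    (hψ : ∀ t ∈ Ioo (-a) a, HasDerivAt ψ (d t * φ t) t)
    (hφ0 : φ 0 = 0) (hψ0 : ψ 0 = 0) {t : ℝ} (ht : t ∈ Ioo (-a) a) : φ t = 0 ∧ ψ t = 0 := by
  obtain ⟨b, htb, hba⟩ := exists_between (abs_lt.2 ht)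
  have hsub : Icc (-b) b ⊆ Ioo (-a) a := fun s hs ↦ ⟨by linarith [hs.1], by linarith [hs.2]⟩
  obtain ⟨C, hC⟩ := isCompact_Icc.exists_bound_of_continuousOn (hc.mono hsub)
  obtain ⟨D, hD⟩ := isCompact_Icc.exists_bound_of_continuousOn (hd.mono hsub)
  have hIoo : Ioo (-b) b ⊆ Icc (-b) b := Ioo_subset_Icc_self
  have h := ODE_solution_unique_of_mem_Ioo (K := (max C D).toNNReal)
    (v := fun t (p : ℝ × ℝ) ↦ (c t * p.2, d t * p.1)) (s := fun _ ↦ univ) (t₀ := 0)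
    (f := fun t ↦ (φ t, ψ t)) (g := fun _ ↦ 0) (a := -b) (b := b) ?_ ?_ ?_ ?_ ?_
  · simpa using h (abs_lt.1 htb)
  · intro s hs
    refine (LipschitzWith.of_dist_le_mul fun p q ↦ ?_).lipschitzOnWith
    have hCs := hC s (hIoo hs)
    have hDs := hD s (hIoo hs)
    have hle := Real.le_coe_toNNReal (max C D)
    simp only [dist_eq_norm, Prod.norm_def, Prod.fst_sub, Prod.snd_sub, ← mul_sub, norm_mul]
    refine max_le ?_ ?_
    · gcongr
      · exact (hCs.trans (le_max_left _ _)).trans hle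
      · exact le_max_right _ _
    · gcongr
      · exact (hDs.trans (le_max_right _ _)).trans hle
      · exact le_max_left _ _
  · have := abs_nonneg t
    constructor <;> linarith
  · intro s hs
    exact ⟨(hφ s (hsub (hIoo hs))).prodMk (hψ s (hsub (hIoo hs))), mem_univ _⟩
  · intro s hs
    exact ⟨by simpa using! hasDerivAt_const s (0 : ℝ × ℝ), mem_univ _⟩
  · simp [hφ0, hψ0]

theorem HasDerivAt.prod_fst {E F : Type*} [NormedAddCommGroup E] [NormedSpace ℝ E]
    [NormedAddCommGroup F] [NormedSpace ℝ F] {f : ℝ → E × F} {f' : E × F} {t : ℝ}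
    (h : HasDerivAt f f' t) : HasDerivAt (fun s ↦ (f s).1) f'.1 t :=
  (ContinuousLinearMap.fst ℝ E F).hasFDerivAt.comp_hasDerivAt t h

theorem HasDerivAt.prod_snd {E F : Type*} [NormedAddCommGroup E] [NormedSpace ℝ E]
    [NormedAddCommGroup F] [NormedSpace ℝ F] {f : ℝ → E × F} {f' : E × F} {t : ℝ}
    (h : HasDerivAt f f' t) : HasDerivAt (fun s ↦ (f s).2) f'.2 t :=
  (ContinuousLinearMap.snd ℝ E F).hasFDerivAt.comp_hasDerivAt t h

section MatrixCalculus

variable {ι : Type*} [Fintype ι]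

theorem hasDerivAt_matrix {A : ℝ → Matrix ι ι ℝ} {A' : Matrix ι ι ℝ} {t : ℝ} :
    HasDerivAt A A' t ↔ ∀ i j, HasDerivAt (fun s ↦ A s i j) (A' i j) t :=
  hasDerivAt_pi.trans (forall_congr' fun _ ↦ hasDerivAt_pi)

theorem contDiff_matrix {E : Type*} [NormedAddCommGroup E] [NormedSpace ℝ E] {n : WithTop ℕ∞}
    {f : E → Matrix ι ι ℝ} : ContDiff ℝ n f ↔ ∀ i j, ContDiff ℝ n (fun x ↦ f x i j) :=
  contDiff_pi.trans (forall_congr' fun _ ↦ contDiff_pi)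

theorem HasDerivAt.matrix_mul {A B : ℝ → Matrix ι ι ℝ} {A' B' : Matrix ι ι ℝ} {t : ℝ}
    (hA : HasDerivAt A A' t) (hB : HasDerivAt B B' t) :
    HasDerivAt (fun s ↦ A s * B s) (A' * B t + A t * B') t := by
  rw [hasDerivAt_matrix] at *
  intro i j
  simp only [mul_apply, Matrix.add_apply, ← Finset.sum_add_distrib]
  exact HasDerivAt.fun_sum fun k _ ↦ (hA i k).fun_mul (hB k j)

theorem HasDerivAt.matrix_transpose {A : ℝ → Matrix ι ι ℝ} {A' : Matrix ι ι ℝ} {t : ℝ}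
    (hA : HasDerivAt A A' t) : HasDerivAt (fun s ↦ (A s)ᵀ) A'ᵀ t :=
  hasDerivAt_matrix.2 fun i j ↦ hasDerivAt_matrix.1 hA j i

theorem HasDerivAt.matrix_trace {A : ℝ → Matrix ι ι ℝ} {A' : Matrix ι ι ℝ} {t : ℝ}
    (hA : HasDerivAt A A' t) : HasDerivAt (fun s ↦ (A s).trace) A'.trace t :=
  HasDerivAt.fun_sum fun i _ ↦ hasDerivAt_matrix.1 hA i i

theorem ContDiff.matrix_entry {E : Type*} [NormedAddCommGroup E] [NormedSpace ℝ E]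
    {n : WithTop ℕ∞} {f : E → Matrix ι ι ℝ} (hf : ContDiff ℝ n f) (i j : ι) :
    ContDiff ℝ n (fun x ↦ f x i j) :=
  contDiff_matrix.1 hf i j

theorem ContDiff.matrix_mul {E : Type*} [NormedAddCommGroup E] [NormedSpace ℝ E]
    {n : WithTop ℕ∞} {f g : E → Matrix ι ι ℝ} (hf : ContDiff ℝ n f) (hg : ContDiff ℝ n g) :
    ContDiff ℝ n (fun x ↦ f x * g x) :=
  contDiff_matrix.2 fun i j ↦
    ContDiff.sum fun k _ ↦ (hf.matrix_entry i k).mul (hg.matrix_entry k j)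

theorem ContDiff.matrix_transpose {E : Type*} [NormedAddCommGroup E] [NormedSpace ℝ E]
    {n : WithTop ℕ∞} {f : E → Matrix ι ι ℝ} (hf : ContDiff ℝ n f) :
    ContDiff ℝ n (fun x ↦ (f x)ᵀ) :=
  contDiff_matrix.2 fun i j ↦ hf.matrix_entry j i

theorem ContDiff.matrix_trace {E : Type*} [NormedAddCommGroup E] [NormedSpace ℝ E]
    {n : WithTop ℕ∞} {f : E → Matrix ι ι ℝ} (hf : ContDiff ℝ n f) :
    ContDiff ℝ n (fun x ↦ (f x).trace) :=
  ContDiff.sum fun i _ ↦ hf.matrix_entry i i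

theorem trace_mul_transpose_nonneg (A : Matrix ι ι ℝ) : 0 ≤ (A * Aᵀ).trace :=
  Finset.sum_nonneg fun i _ ↦ Finset.sum_nonneg fun j _ ↦ mul_self_nonneg (A i j)

theorem norm_le_sqrt_trace_mul_transpose (B : Matrix ι ι ℝ) : ‖B‖ ≤ √(B * Bᵀ).trace := by
  refine (Matrix.norm_le_iff (Real.sqrt_nonneg _)).2 fun i j ↦ Real.le_sqrt_of_sq_le ?_
  have h : ∀ k, 0 ≤ ∑ l, B k l * B k l := fun k ↦ Finset.sum_nonneg fun l _ ↦ mul_self_nonneg _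
  calc ‖B i j‖ ^ 2 = B i j * B i j := by rw [Real.norm_eq_abs, sq_abs, sq]
    _ ≤ ∑ l, B i l * B i l :=
      Finset.single_le_sum (f := fun l ↦ B i l * B i l) (fun l _ ↦ mul_self_nonneg _)
        (Finset.mem_univ j)
    _ ≤ ∑ k, ∑ l, B k l * B k l :=
      Finset.single_le_sum (f := fun k ↦ ∑ l, B k l * B k l) (fun k _ ↦ h k) (Finset.mem_univ i)
    _ = (B * Bᵀ).trace := by simp [trace, mul_apply]

variable [DecidableEq ι]

/-- The determinant as a continuous multilinear function of the rows. -/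
def detRowContinuousMultilinear (ι : Type*) [Fintype ι] [DecidableEq ι] :
    ContinuousMultilinearMap ℝ (fun _ : ι ↦ ι → ℝ) ℝ where
  toMultilinearMap := (detRowAlternating (n := ι) (R := ℝ)).toMultilinearMap
  cont := Continuous.matrix_det (A := fun M : Matrix ι ι ℝ ↦ M) continuous_id

theorem contDiff_det {n : WithTop ℕ∞} : ContDiff ℝ n (fun A : Matrix ι ι ℝ ↦ A.det) :=
  (detRowContinuousMultilinear ι).contDiff

theorem contDiff_adjugate {n : WithTop ℕ∞} :
    ContDiff ℝ n (fun A : Matrix ι ι ℝ ↦ A.adjugate) := by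
  refine contDiff_matrix.2 fun i j ↦ ?_
  simp only [adjugate_apply]
  refine contDiff_det.comp (contDiff_matrix.2 fun k l ↦ ?_)
  simp only [updateRow_apply]
  split_ifs
  · exact contDiff_const
  · exact contDiff_id.matrix_entry k l

/-- **Jacobi's formula**. -/
theorem HasDerivAt.matrix_det {A : ℝ → Matrix ι ι ℝ} {A' : Matrix ι ι ℝ} {t : ℝ}
    (hA : HasDerivAt A A' t) :
    HasDerivAt (fun s ↦ (A s).det) ((A t).adjugate * A').trace t := by
  have h := ((detRowContinuousMultilinear ι).hasFDerivAt (A t)).comp_hasDerivAt t hA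
  convert! h using 1
  have hrow : ∀ i, ((A t).updateRow i (A' i)).det = ∑ j, (A t).adjugate j i * A' i j := by
    intro i
    rw [← cramer_transpose_apply, cramer_eq_adjugate_mulVec, ← adjugate_transpose]
    rfl
  calc ((A t).adjugate * A').trace = ∑ i, ∑ j, (A t).adjugate j i * A' i j := by
        rw [Finset.sum_comm]; rfl
    _ = ∑ i, ((A t).updateRow i (A' i)).det := by simp only [hrow]
    _ = ∑ i, detRowContinuousMultilinear ι (Function.update (A t) i (A' i)) := rfl
    _ = (detRowContinuousMultilinear ι).linearDeriv (A t) A' :=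
      ((detRowContinuousMultilinear ι).linearDeriv_apply (A t) A').symm

theorem HasDerivAt.matrix_adjugate {A : ℝ → Matrix ι ι ℝ} {A' : Matrix ι ι ℝ} {t : ℝ}
    (hA : HasDerivAt A A' t) :
    HasDerivAt (fun s ↦ (A s).adjugate) (fderiv ℝ adjugate (A t) A') t :=
  (contDiff_adjugate.differentiable one_ne_zero).differentiableAt.hasFDerivAt.comp_hasDerivAt t hA

end MatrixCalculus

section GeodesicField

variable {ι : Type*} [Fintype ι] [DecidableEq ι]

/-- A quantity that equals `tr (A⁻¹ (A⁻¹)ᵀ)` where `det A = 1`, and is positive for all `A`. -/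
def geodesicDenom (A : Matrix ι ι ℝ) : ℝ :=
  (A.adjugate * A.adjugateᵀ).trace + (A.det - 1) ^ 2

/-- The second derivative of `det` at `A` in the direction `B`. -/
def detHessian (A B : Matrix ι ι ℝ) : ℝ :=
  (fderiv ℝ adjugate A B * B).trace

/-- The Lagrange multiplier of the geodesic equation. -/
def geodesicMultiplier (p : Matrix ι ι ℝ × Matrix ι ι ℝ) : ℝ :=
  -detHessian p.1 p.2 / geodesicDenom p.1

/-- A smooth vector field on pairs (position, velocity) that restricts to the geodesic spray of
`SL(n)` on the tangent bundle. -/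
def geodesicField (p : Matrix ι ι ℝ × Matrix ι ι ℝ) : Matrix ι ι ℝ × Matrix ι ι ℝ :=
  (p.2, geodesicMultiplier p • p.1.adjugateᵀ)

theorem geodesicDenom_pos [Nonempty ι] (A : Matrix ι ι ℝ) : 0 < geodesicDenom A := by
  have h1 := trace_mul_transpose_nonneg A.adjugate
  have h2 := sq_nonneg (A.det - 1)
  refine lt_of_le_of_ne (add_nonneg h1 h2) fun h ↦ ?_
  unfold geodesicDenom at h
  have hadj : A.adjugate = 0 := by
    have h3 := norm_le_sqrt_trace_mul_transpose A.adjugate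
    rw [show (A.adjugate * A.adjugateᵀ).trace = 0 by linarith, Real.sqrt_zero] at h3
    exact norm_le_zero_iff.1 h3
  have hdet : A.det = 1 := by nlinarith
  have := A.mul_adjugate
  rw [hadj, hdet, mul_zero, one_smul] at this
  exact zero_ne_one this

theorem contDiff_geodesicDenom {n : WithTop ℕ∞} :
    ContDiff ℝ n (geodesicDenom : Matrix ι ι ℝ → ℝ) :=
  (contDiff_adjugate.matrix_mul contDiff_adjugate.matrix_transpose).matrix_trace.add
    ((contDiff_det.sub contDiff_const).pow 2)

theorem contDiff_detHessian :
    ContDiff ℝ 1 (fun p : Matrix ι ι ℝ × Matrix ι ι ℝ ↦ detHessian p.1 p.2) := by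
  refine (ContDiff.matrix_mul ?_ contDiff_snd).matrix_trace
  exact (((contDiff_adjugate (n := 2)).fderiv_right (m := 1) (by norm_num)).comp
    contDiff_fst).clm_apply contDiff_snd

theorem contDiff_geodesicField [Nonempty ι] :
    ContDiff ℝ 1 (geodesicField : Matrix ι ι ℝ × Matrix ι ι ℝ → _) :=
  contDiff_snd.prodMk ((contDiff_detHessian.neg.div (contDiff_geodesicDenom.comp contDiff_fst)
    fun p ↦ (geodesicDenom_pos p.1).ne').smul
      (contDiff_adjugate.comp contDiff_fst).matrix_transpose)

variable [Nonempty ι] {γ : ℝ → Matrix ι ι ℝ × Matrix ι ι ℝ} {c : ℝ → ℝ} {a : ℝ}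

theorem det_eq_one_and_trace_eq_zero (hc : ContinuousOn c (Ioo (-a) a))
    (hγ : ∀ t ∈ Ioo (-a) a, HasDerivAt γ (c t • geodesicField (γ t)) t)
    (hdet : (γ 0).1.det = 1) (htr : ((γ 0).1.adjugate * (γ 0).2).trace = 0)
    {t : ℝ} (ht : t ∈ Ioo (-a) a) :
    (γ t).1.det = 1 ∧ ((γ t).1.adjugate * (γ t).2).trace = 0 := by
  have hcont : ContinuousOn γ (Ioo (-a) a) := fun s hs ↦ (hγ s hs).continuousAt.continuousWithinAt
  have h := eq_zero_of_hasDerivAt_mul (φ := fun s ↦ (γ s).1.det - 1)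
    (ψ := fun s ↦ ((γ s).1.adjugate * (γ s).2).trace)
    (d := fun s ↦ c s * (detHessian (γ s).1 (γ s).2 * ((γ s).1.det - 1) / geodesicDenom (γ s).1))
    hc ?_ ?_ ?_ (by simp [hdet]) htr ht
  · exact ⟨sub_eq_zero.1 h.1, h.2⟩
  · refine hc.mul (Continuous.comp_continuousOn (g := fun p : Matrix ι ι ℝ × Matrix ι ι ℝ ↦
      detHessian p.1 p.2 * (p.1.det - 1) / geodesicDenom p.1) ?_ hcont)
    exact (contDiff_detHessian.continuous.mul
      ((contDiff_det (n := 1)).continuous.comp continuous_fst |>.sub continuous_const)).div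
      ((contDiff_geodesicDenom (n := 1)).continuous.comp continuous_fst)
      fun p ↦ (geodesicDenom_pos p.1).ne'
  · intro s hs
    convert! (hγ s hs).prod_fst.matrix_det.sub_const 1 using 1
    simp [geodesicField]
  · intro s hs
    convert! ((hγ s hs).prod_fst.matrix_adjugate.matrix_mul (hγ s hs).prod_snd).matrix_trace using 1
    have hpos := (geodesicDenom_pos (γ s).1).ne'
    simp only [geodesicField, Prod.smul_fst, Prod.smul_snd, map_smul, Matrix.smul_mul,
      Matrix.mul_smul,
      trace_add, trace_smul, smul_eq_mul]
    rw [show (fderiv ℝ adjugate (γ s).1 (γ s).2 * (γ s).2).trace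
        = detHessian (γ s).1 (γ s).2 from rfl,
      show ((γ s).1.adjugate * (γ s).1.adjugateᵀ).trace
        = geodesicDenom (γ s).1 - ((γ s).1.det - 1) ^ 2 by simp [geodesicDenom]]
    unfold geodesicMultiplier
    field_simp
    ring

theorem trace_velocity_mul_transpose_eq (hc : ContinuousOn c (Ioo (-a) a))
    (hγ : ∀ t ∈ Ioo (-a) a, HasDerivAt γ (c t • geodesicField (γ t)) t)
    (hdet : (γ 0).1.det = 1) (htr : ((γ 0).1.adjugate * (γ 0).2).trace = 0)
    {t : ℝ} (ht : t ∈ Ioo (-a) a) :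
    ((γ t).2 * (γ t).2ᵀ).trace = ((γ 0).2 * (γ 0).2ᵀ).trace := by
  have h := eq_zero_of_hasDerivAt_mul (c := 0) (d := 0) (ψ := 0)
    (φ := fun s ↦ ((γ s).2 * (γ s).2ᵀ).trace - ((γ 0).2 * (γ 0).2ᵀ).trace)
    continuousOn_const continuousOn_const ?_ ?_ (sub_self _) rfl ht
  · exact sub_eq_zero.1 h.1
  · intro s hs
    convert! (((hγ s hs).prod_snd.matrix_mul (hγ s hs).prod_snd.matrix_transpose).matrix_trace).sub_const _
      using 1
    have h0 := (det_eq_one_and_trace_eq_zero hc hγ hdet htr hs).2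
    have h1 : ((γ s).1.adjugateᵀ * (γ s).2ᵀ).trace = 0 := by
      rw [← transpose_mul, trace_transpose, trace_mul_comm, h0]
    have h2 : ((γ s).2 * (γ s).1.adjugate).trace = 0 := by rw [trace_mul_comm, h0]
    simp [geodesicField, h1, h2]
  · intro s _
    simp

theorem norm_le_of_hasDerivAt_smul_geodesicField (hc : ContinuousOn c (Ioo (-a) a))
    (hc1 : ∀ t, |c t| ≤ 1)
    (hγ : ∀ t ∈ Ioo (-a) a, HasDerivAt γ (c t • geodesicField (γ t)) t)
    (hdet : (γ 0).1.det = 1) (htr : ((γ 0).1.adjugate * (γ 0).2).trace = 0)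
    {t : ℝ} (ht : t ∈ Ioo (-a) a) :
    ‖γ t‖ ≤ max (‖(γ 0).1‖ + √((γ 0).2 * (γ 0).2ᵀ).trace * a) √((γ 0).2 * (γ 0).2ᵀ).trace := by
  set C := √((γ 0).2 * (γ 0).2ᵀ).trace with hC
  have hB : ∀ s ∈ Ioo (-a) a, ‖(γ s).2‖ ≤ C := fun s hs ↦ by
    rw [hC, ← trace_velocity_mul_transpose_eq hc hγ hdet htr hs]
    exact norm_le_sqrt_trace_mul_transpose _
  have h0 : (0 : ℝ) ∈ Ioo (-a) a := by constructor <;> linarith [ht.1, ht.2]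
  have hA := (convex_Ioo (-a) a).norm_image_sub_le_of_norm_hasDerivWithin_le (C := C)
    (f := fun s ↦ (γ s).1) (fun s hs ↦ (hγ s hs).prod_fst.hasDerivWithinAt) (fun s hs ↦ ?_) h0 ht
  · refine max_le_max ?_ (hB t ht)
    have h1 : ‖t - 0‖ ≤ a := by simpa using (abs_lt.2 ht).le
    have h2 : C * ‖t - 0‖ ≤ C * a := by gcongr
    linarith [norm_le_norm_add_norm_sub (γ 0).1 (γ t).1, norm_sub_rev (γ 0).1 (γ t).1]
  · calc ‖c s • (γ s).2‖ = |c s| * ‖(γ s).2‖ := norm_smul _ _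
      _ ≤ 1 * C := by gcongr; exacts [hc1 s, hB s hs]
      _ = C := one_mul C

end GeodesicField

theorem exists_geodesic {ι : Type*} [Fintype ι] [DecidableEq ι] [Nonempty ι] (A₀ A₁ : Matrix ι ι ℝ)
    (h₀ : A₀.det = 1) (h₁ : Matrix.trace (A₀⁻¹ * A₁) = 0) :
    ∃ A : ℝ → Matrix ι ι ℝ,
      ContDiff ℝ 2 A ∧ A 0 = A₀ ∧ deriv A 0 = A₁ ∧
      (∀ t, (A t).det = 1) ∧
      (∀ t, deriv (deriv A) t =
        (Matrix.trace (deriv A t * (A t)⁻¹ * deriv A t * (A t)⁻¹) /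
          Matrix.trace ((A t)⁻¹ * ((A t)⁻¹)ᵀ)) • ((A t)⁻¹)ᵀ) := by
  have hinv : ∀ {M : Matrix ι ι ℝ}, M.det = 1 → M⁻¹ = M.adjugate := fun h ↦ by simp [inv_def, h]
  rw [hinv h₀] at h₁
  obtain ⟨γ, hγ0, hγ⟩ := exists_isIntegralCurve_of_bounded contDiff_geodesicField (A₀, A₁)
    fun a _ ↦ ⟨_, fun γ c h0 hc hc1 hγ t ht ↦ by
      have := norm_le_of_hasDerivAt_smul_geodesicField hc hc1 hγ (by rwa [h0]) (by rwa [h0]) ht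
      rwa [h0] at this⟩
  have hdet : ∀ t, (γ t).1.det = 1 := fun t ↦
    (det_eq_one_and_trace_eq_zero (c := 1) (a := |t| + 1) continuousOn_const
      (fun s _ ↦ by simpa using! hγ s) (by rwa [hγ0]) (by rwa [hγ0])
      (abs_lt.1 (lt_add_one |t|))).1
  have hderiv : deriv (fun t ↦ (γ t).1) = fun t ↦ (γ t).2 := funext fun t ↦ (hγ t).prod_fst.deriv
  have hdγ : deriv γ = fun t ↦ geodesicField (γ t) := funext fun t ↦ (hγ t).deriv
  have hdiff : Differentiable ℝ γ := fun t ↦ (hγ t).differentiableAt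
  have hγ1 : ContDiff ℝ 1 γ := contDiff_one_iff_deriv.2
    ⟨hdiff, hdγ ▸ contDiff_geodesicField.continuous.comp hdiff.continuous⟩
  have hγ2 : ContDiff ℝ 2 γ := (contDiff_succ_iff_deriv (n := 1)).2
    ⟨hdiff, by simp, hdγ ▸ contDiff_geodesicField.comp hγ1⟩
  refine ⟨fun t ↦ (γ t).1, contDiff_fst.comp hγ2, by simp [hγ0], by simp [hderiv, hγ0], hdet,
    fun t ↦ ?_⟩
  rw [hderiv]
  refine (hγ t).prod_snd.deriv.trans ?_
  simp only [hinv (hdet t), geodesicField, geodesicMultiplier, geodesicDenom, hdet t, sub_self]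
  have hconst : HasDerivAt (fun s ↦ (γ s).1 * (γ s).1.adjugate) 0 t := by
    simpa only [mul_adjugate, hdet, one_smul] using! hasDerivAt_const t (1 : Matrix ι ι ℝ)
  have hprod := ((hγ t).prod_fst.matrix_mul (hγ t).prod_fst.matrix_adjugate).unique hconst
  have hadj : fderiv ℝ adjugate (γ t).1 (γ t).2
      = -((γ t).1.adjugate * (γ t).2 * (γ t).1.adjugate) := by
    have h := congrArg ((γ t).1.adjugate * ·) hprod
    simp only [geodesicField, mul_add, mul_zero, ← mul_assoc, adjugate_mul, hdet, one_smul,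
      one_mul] at h
    exact eq_neg_of_add_eq_zero_right h
  have hH : -detHessian (γ t).1 (γ t).2
      = ((γ t).2 * (γ t).1.adjugate * (γ t).2 * (γ t).1.adjugate).trace := by
    rw [detHessian, hadj, neg_mul, trace_neg, neg_neg, trace_mul_comm]
    simp only [mul_assoc]
  rw [hH]
  simp

end GeodesicCompleteness

/-- geodesic completeness of `SL(n)` with the Hilbert–Schmidt metric:
every admissible initial condition extends to a globally defined `C²` solution of
the geodesic equation. -/
theorem statement_6 {n : ℕ} (A₀ A₁ : Matrix (Fin n) (Fin n) ℝ)
    (h₀ : A₀.det = 1) (h₁ : Matrix.trace (A₀⁻¹ * A₁) = 0) :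
    ∃ A : ℝ → Matrix (Fin n) (Fin n) ℝ,
      ContDiff ℝ 2 A ∧ A 0 = A₀ ∧ deriv A 0 = A₁ ∧
      (∀ t, (A t).det = 1) ∧
      (∀ t, deriv (deriv A) t =
        (Matrix.trace (deriv A t * (A t)⁻¹ * deriv A t * (A t)⁻¹) /
          Matrix.trace ((A t)⁻¹ * ((A t)⁻¹)ᵀ)) • ((A t)⁻¹)ᵀ) := by
  rcases isEmpty_or_nonempty (Fin n) with h | h
  · exact ⟨fun _ ↦ A₀, contDiff_const, rfl, Subsingleton.elim _ _, fun _ ↦ h₀,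
      fun _ ↦ Subsingleton.elim _ _⟩
  · exact exists_geodesic A₀ A₁ h₀ h₁
end
end

section
/- Let A₀ ∈ M_n(ℝ) with det A₀ = 1, and let A₁ ∈ M_n(ℝ) be nonzero with tr(A₀⁻¹·A₁) = 0. Assume at least one of the following holds: (i) there exist O ∈ SO(n) and a symmetric positive definite P with A₀ = O·P and Oᵀ·A₁ symmetric; (ii) A₀ᵀ·A₁ is symmetric; (iii) A₁·A₀ᵀ is symmetric. Then any geodesic A of SL(n) with the Hilbert–Schmidt metric satisfying A(0) = A₀ and A'(0) = A₁ satisfies tr(A'(t)·A(t)⁻¹·A'(t)·A(t)⁻¹) > 0 for all t ∈ ℝ, and ‖A(t)‖ → ∞ both as t → +∞ and as t → −∞. -/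
noncomputable section
open Matrix Filter

attribute [local instance] Matrix.normedAddCommGroup Matrix.normedSpace

theorem hasDerivAt_matrix_iff {m n : ℕ} {M : ℝ → Matrix (Fin m) (Fin n) ℝ}
    {M' : Matrix (Fin m) (Fin n) ℝ} {t : ℝ} :
    HasDerivAt M M' t ↔ ∀ i j, HasDerivAt (fun s => M s i j) (M' i j) t := by
  have h1 : HasDerivAt M M' t ↔ ∀ i, HasDerivAt (fun s => M s i) (M' i) t :=
    hasDerivAt_pi (φ := fun s i => M s i)
  rw [h1]
  exact forall_congr' fun i => hasDerivAt_pi (φ := fun s j => M s i j)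

section Calculus

variable {n : ℕ} {M N : ℝ → Matrix (Fin n) (Fin n) ℝ} {M' N' : Matrix (Fin n) (Fin n) ℝ} {t : ℝ}

theorem HasDerivAt.matrix_mul_apply (hM : HasDerivAt M M' t) (hN : HasDerivAt N N' t) :
    HasDerivAt (fun s => M s * N s) (M' * N t + M t * N') t := by
  rw [hasDerivAt_matrix_iff] at *
  intro i j
  simp only [Matrix.mul_apply, Matrix.add_apply, ← Finset.sum_add_distrib]
  exact HasDerivAt.fun_sum fun k _ => (hM i k).mul (hN k j)

theorem HasDerivAt.matrix_const_mul_apply (C : Matrix (Fin n) (Fin n) ℝ)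
    (hM : HasDerivAt M M' t) : HasDerivAt (fun s => C * M s) (C * M') t :=
  ((hasDerivAt_const t C).matrix_mul_apply hM).congr_deriv (by simp)

theorem HasDerivAt.matrix_transpose_apply (hM : HasDerivAt M M' t) :
    HasDerivAt (fun s => (M s)ᵀ) M'ᵀ t := by
  rw [hasDerivAt_matrix_iff] at *
  exact fun i j => hM j i

theorem HasDerivAt.matrix_trace_apply (hM : HasDerivAt M M' t) :
    HasDerivAt (fun s => (M s).trace) M'.trace t := by
  rw [hasDerivAt_matrix_iff] at hM
  simp only [Matrix.trace, Matrix.diag]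
  exact HasDerivAt.fun_sum fun k _ => hM k k

theorem DifferentiableAt.matrix_det_apply (hM : DifferentiableAt ℝ M t) :
    DifferentiableAt ℝ (fun s => (M s).det) t := by
  have h := hasDerivAt_matrix_iff.1 hM.hasDerivAt
  have h' : ∀ i j, DifferentiableAt ℝ (fun s => M s i j) t :=
    fun i j => (h i j).differentiableAt
  simp only [Matrix.det_apply']
  fun_prop

theorem DifferentiableAt.matrix_adjugate_apply (hM : DifferentiableAt ℝ M t) :
    DifferentiableAt ℝ (fun s => (M s).adjugate) t := by
  have h := hasDerivAt_matrix_iff.1 hM.hasDerivAt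
  have key : ∀ i j, DifferentiableAt ℝ (fun s => (M s).adjugate i j) t := by
    intro i j
    simp only [Matrix.adjugate_apply]
    apply DifferentiableAt.matrix_det_apply
    apply HasDerivAt.differentiableAt
      (f' := (deriv M t).updateRow j 0)
    refine hasDerivAt_matrix_iff.2 fun a b => ?_
    by_cases hab : a = j
    · subst hab
      simpa using hasDerivAt_const t _
    · simp only [Matrix.updateRow_ne hab]
      exact h a b
  exact (hasDerivAt_matrix_iff (M' := fun i j => deriv (fun s => (M s).adjugate i j) t).2
    fun i j => (key i j).hasDerivAt).differentiableAt

theorem HasDerivAt.matrix_inv_apply (hM : HasDerivAt M M' t) (hdet : ∀ s, (M s).det = 1) :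
    HasDerivAt (fun s => (M s)⁻¹) (-((M t)⁻¹ * M' * (M t)⁻¹)) t := by
  have hu : ∀ s, IsUnit (M s).det := fun s => by simp [hdet s]
  have hd : DifferentiableAt ℝ (fun s => (M s)⁻¹) t := by
    have : (fun s => (M s)⁻¹) = fun s => (M s).adjugate := by
      funext s
      simp [Matrix.inv_def, hdet s]
    rw [this]
    exact hM.differentiableAt.matrix_adjugate_apply
  have h1 := hM.matrix_mul_apply hd.hasDerivAt
  have h2 : (fun s => M s * (M s)⁻¹) = fun _ => 1 :=
    funext fun s => Matrix.mul_nonsing_inv _ (hu s)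
  rw [h2] at h1
  have h3 := h1.unique (hasDerivAt_const t _)
  have h4 : _root_.deriv (fun s => (M s)⁻¹) t = -((M t)⁻¹ * M' * (M t)⁻¹) := by
    have h5 := congrArg (fun X => (M t)⁻¹ * X) h3
    simp only [Matrix.mul_add, Matrix.mul_zero, Matrix.nonsing_inv_mul_cancel_left _ _ (hu t)] at h5
    rw [eq_neg_iff_add_eq_zero, add_comm, Matrix.mul_assoc]
    exact h5
  rw [← h4]
  exact hd.hasDerivAt

end Calculus

theorem Matrix.norm_mul_le_card_mul {n : ℕ} (X Y : Matrix (Fin n) (Fin n) ℝ) :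
    ‖X * Y‖ ≤ n * ‖X‖ * ‖Y‖ := by
  rw [Matrix.norm_le_iff (by positivity)]
  intro i j
  rw [Matrix.mul_apply]
  calc ‖∑ k, X i k * Y k j‖ ≤ ∑ k : Fin n, ‖X‖ * ‖Y‖ := by
        refine norm_sum_le_of_le _ fun k _ => ?_
        rw [norm_mul]
        gcongr <;> exact Matrix.norm_entry_le_entrywise_sup_norm _
    _ = n * ‖X‖ * ‖Y‖ := by simp [mul_assoc]

theorem Matrix.trace_mul_self_transpose_pos {m n : ℕ} {X : Matrix (Fin m) (Fin n) ℝ} (hX : X ≠ 0) :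
    0 < (X * Xᵀ).trace := by
  have h1 : 0 ≤ (X * Xᴴ).trace := (Matrix.posSemidef_self_mul_conjTranspose X).trace_nonneg
  have h2 : (X * Xᴴ).trace ≠ 0 := fun h => hX (Matrix.trace_mul_conjTranspose_self_eq_zero_iff.1 h)
  simpa [Matrix.conjTranspose_eq_transpose_of_trivial] using lt_of_le_of_ne h1 h2.symm

theorem Matrix.trace_mul_self_pos_of_symm {n : ℕ} {X : Matrix (Fin n) (Fin n) ℝ}
    (hX : X ≠ 0) (hs : Xᵀ = X) : 0 < (X * X).trace := by
  simpa [hs] using Matrix.trace_mul_self_transpose_pos hX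

open scoped MatrixOrder Matrix.Norms.L2Operator in
theorem Matrix.PosSemidef.exists_eq_transpose_mul_self {n : ℕ} {B : Matrix (Fin n) (Fin n) ℝ}
    (hB : B.PosSemidef) : ∃ R : Matrix (Fin n) (Fin n) ℝ, B = Rᵀ * R :=
  CStarAlgebra.nonneg_iff_eq_star_mul_self.1 hB.nonneg

theorem Matrix.PosDef.trace_mul_inv_mul_mul_inv_pos {n : ℕ} {B C : Matrix (Fin n) (Fin n) ℝ}
    (hB : B.PosDef) (hC : C ≠ 0) (hs : Cᵀ = C) : 0 < (C * B⁻¹ * C * B⁻¹).trace := by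
  obtain ⟨R, hR⟩ := hB.inv.posSemidef.exists_eq_transpose_mul_self
  have hRu : IsUnit R := by
    have h := hB.inv.isUnit
    rw [hR, Matrix.isUnit_iff_isUnit_det, Matrix.det_mul] at h
    exact (Matrix.isUnit_iff_isUnit_det R).2 (isUnit_of_mul_isUnit_right h)
  have hRt : IsUnit Rᵀ := by simpa using hRu
  have hne : R * C * Rᵀ ≠ 0 := by
    intro h
    rw [hRt.mul_left_eq_zero, hRu.mul_right_eq_zero] at h
    exact hC h
  have h := Matrix.trace_mul_self_pos_of_symm hne
    (by simp [Matrix.transpose_mul, hs, Matrix.mul_assoc])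
  rw [hR]
  convert h using 1
  rw [show C * (Rᵀ * R) * C * (Rᵀ * R) = (C * (Rᵀ * R) * C * Rᵀ) * R by
    simp only [Matrix.mul_assoc], Matrix.trace_mul_comm]
  simp only [Matrix.mul_assoc]

/-- A solution of a second-order linear system with vanishing initial data vanishes for
positive times. -/
theorem eq_zero_of_norm_deriv_deriv_le_right {E : Type*} [NormedAddCommGroup E] [NormedSpace ℝ E]
    {X Y Z : ℝ → E} {K : ℝ → ℝ} (hX : ∀ t, HasDerivAt X (Y t) t) (hY : ∀ t, HasDerivAt Y (Z t) t)
    (hK : Continuous K) (hZ : ∀ t, ‖Z t‖ ≤ K t * ‖X t‖) (hX0 : X 0 = 0) (hY0 : Y 0 = 0)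
    {t : ℝ} (ht : 0 ≤ t) : X t = 0 := by
  obtain ⟨C, hC⟩ := (isCompact_Icc (a := (0 : ℝ)) (b := t)).bddAbove_image hK.continuousOn
  have hder : ∀ s, HasDerivAt (fun s => (X s, Y s)) (Y s, Z s) s :=
    fun s => (hX s).prodMk (hY s)
  have h := eq_zero_of_abs_deriv_le_mul_abs_self_of_eq_zero_right (a := 0) (b := t)
    (K := max 1 C) (f := fun s => (X s, Y s)) (f' := fun s => (Y s, Z s))
    (fun s _ => (hder s).continuousAt.continuousWithinAt)
    (fun s _ => (hder s).hasDerivWithinAt) (by simp [hX0, hY0]) ?_ t ⟨ht, le_rfl⟩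
  · exact congrArg Prod.fst h
  · intro s hs
    have hx : ‖X s‖ ≤ ‖(X s, Y s)‖ := norm_fst_le (X s, Y s)
    have hy : ‖Y s‖ ≤ ‖(X s, Y s)‖ := norm_snd_le (X s, Y s)
    have hKs : K s ≤ C := hC ⟨s, ⟨hs.1, hs.2.le⟩, rfl⟩
    rw [Prod.norm_mk (Y s)]
    refine max_le (hy.trans ?_) ((hZ s).trans ?_)
    · exact le_mul_of_one_le_left (norm_nonneg _) (le_max_left _ _)
    · have : K s ≤ max 1 C := hKs.trans (le_max_right _ _)
      gcongr

/-- A solution of a second-order linear system with vanishing initial data vanishes. -/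
theorem eq_zero_of_norm_deriv_deriv_le {E : Type*} [NormedAddCommGroup E] [NormedSpace ℝ E]
    {X Y Z : ℝ → E} {K : ℝ → ℝ} (hX : ∀ t, HasDerivAt X (Y t) t) (hY : ∀ t, HasDerivAt Y (Z t) t)
    (hK : Continuous K) (hZ : ∀ t, ‖Z t‖ ≤ K t * ‖X t‖) (hX0 : X 0 = 0) (hY0 : Y 0 = 0)
    (t : ℝ) : X t = 0 := by
  rcases le_total 0 t with ht | ht
  · exact eq_zero_of_norm_deriv_deriv_le_right hX hY hK hZ hX0 hY0 ht
  · have hX' : ∀ s, HasDerivAt (fun s => X (-s)) (-Y (-s)) s := fun s =>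
      ((hX (-s)).scomp s (hasDerivAt_neg s)).congr_deriv (by simp)
    have hY' : ∀ s, HasDerivAt (fun s => -Y (-s)) (Z (-s)) s := fun s =>
      (((hY (-s)).scomp s (hasDerivAt_neg s)).neg).congr_deriv (by simp)
    simpa using eq_zero_of_norm_deriv_deriv_le_right hX' hY' (hK.comp continuous_neg)
      (fun s => hZ (-s)) (by simpa using hX0) (by simpa using hY0) (neg_nonneg.2 ht)

theorem tendsto_atTop_of_le_deriv_deriv {f f₁ f₂ : ℝ → ℝ} {c : ℝ} (hc : 0 < c)
    (hf : ∀ t, HasDerivAt f (f₁ t) t) (hf₁ : ∀ t, HasDerivAt f₁ (f₂ t) t) (h : ∀ t, c ≤ f₂ t) :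
    Tendsto f atTop atTop := by
  have hg : ∀ t, HasDerivAt (fun t => f₁ t - c * t) (f₂ t - c) t := fun t =>
    ((hf₁ t).sub ((hasDerivAt_id t).const_mul c)).congr_deriv (by simp)
  have hgm : Monotone fun t => f₁ t - c * t :=
    monotone_of_deriv_nonneg (fun t => (hg t).differentiableAt) fun t => by
      rw [(hg t).deriv]
      exact sub_nonneg.2 (h t)
  have hk : ∀ t, HasDerivAt (fun t => f t - (f₁ 0 * t + c / 2 * t ^ 2))
      (f₁ t - (f₁ 0 + c * t)) t := fun t => by
    refine ((hf t).sub (((hasDerivAt_id t).const_mul (f₁ 0)).add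
      (((hasDerivAt_id t).pow 2).const_mul (c / 2)))).congr_deriv ?_
    simp
    ring
  have hkm : MonotoneOn (fun t => f t - (f₁ 0 * t + c / 2 * t ^ 2)) (Set.Ici 0) :=
    monotoneOn_of_deriv_nonneg (convex_Ici 0)
      (fun t _ => (hk t).continuousAt.continuousWithinAt)
      (fun t _ => (hk t).differentiableAt.differentiableWithinAt) fun t ht => by
        rw [interior_Ici] at ht
        rw [(hk t).deriv]
        have := hgm (le_of_lt ht)
        simp only at this
        linarith
  have hlim : Tendsto (fun t : ℝ => f 0 + t * (f₁ 0 + c / 2 * t)) atTop atTop :=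
    tendsto_atTop_add_const_left _ _ (tendsto_id.atTop_mul_atTop₀
      (tendsto_atTop_add_const_left _ _ (tendsto_id.const_mul_atTop (by positivity))))
  refine tendsto_atTop_mono' _ ?_ hlim
  filter_upwards [eventually_ge_atTop 0] with t ht
  have := hkm (Set.self_mem_Ici) ht ht
  simp only at this
  linarith

theorem tendsto_atBot_of_le_deriv_deriv {f f₁ f₂ : ℝ → ℝ} {c : ℝ} (hc : 0 < c)
    (hf : ∀ t, HasDerivAt f (f₁ t) t) (hf₁ : ∀ t, HasDerivAt f₁ (f₂ t) t) (h : ∀ t, c ≤ f₂ t) :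
    Tendsto f atBot atTop := by
  have hf' : ∀ s, HasDerivAt (fun s => f (-s)) (-f₁ (-s)) s := fun s =>
      ((hf (-s)).scomp s (hasDerivAt_neg s)).congr_deriv (by simp)
  have hf₁' : ∀ s, HasDerivAt (fun s => -f₁ (-s)) (f₂ (-s)) s := fun s =>
      (((hf₁ (-s)).scomp s (hasDerivAt_neg s)).neg).congr_deriv (by simp)
  have := (tendsto_atTop_of_le_deriv_deriv hc hf' hf₁' fun s => h (-s)).comp
    tendsto_neg_atBot_atTop
  simpa [Function.comp_def] using this

/-- A continuous path of invertible symmetric matrices that is positive definite at one time is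
positive definite at all times. -/
theorem Matrix.posDef_of_continuous_of_det_ne_zero {n : ℕ} {B : ℝ → Matrix (Fin n) (Fin n) ℝ}
    (hB : Continuous B) (hs : ∀ t, (B t)ᵀ = B t) (hdet : ∀ t, (B t).det ≠ 0) {t₀ : ℝ}
    (h0 : (B t₀).PosDef) (t : ℝ) : (B t).PosDef := by
  rcases isEmpty_or_nonempty (Fin n) with hn | hn
  · exact ⟨hs t, fun x hx => (hx (Subsingleton.elim _ _)).elim⟩
  have hherm : ∀ t, (B t).IsHermitian := fun t => by
    rw [Matrix.IsHermitian, Matrix.conjTranspose_eq_transpose_of_trivial, hs]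
  let S : Set (Fin n → ℝ) := Metric.sphere 0 1
  have hS : IsCompact S := isCompact_sphere 0 1
  have hSne : S.Nonempty := NormedSpace.sphere_nonempty.2 zero_le_one
  have hcont : Continuous fun p : ℝ × (Fin n → ℝ) => p.2 ⬝ᵥ (B p.1 *ᵥ p.2) := by fun_prop
  have hcont' : ∀ t, Continuous fun x : Fin n → ℝ => x ⬝ᵥ (B t *ᵥ x) := fun t => by fun_prop
  let m : ℝ → ℝ := fun t => sInf ((fun x : Fin n → ℝ => x ⬝ᵥ (B t *ᵥ x)) '' S)
  have hm : Continuous m := hS.continuous_sInf hcont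
  have hatt : ∀ t, ∃ x ∈ S, m t = x ⬝ᵥ (B t *ᵥ x) ∧ ∀ y ∈ S, m t ≤ y ⬝ᵥ (B t *ᵥ y) := fun t => by
    obtain ⟨x, hx, h1, h2⟩ := hS.exists_sInf_image_eq_and_le hSne (hcont' t).continuousOn
    exact ⟨x, hx, h1, fun y hy => h1.trans_le (h2 y hy)⟩
  have hSne0 : ∀ x ∈ S, x ≠ 0 := fun x hx h => by
    simp [S, h] at hx
  have hscale : ∀ t (x : Fin n → ℝ), m t * ‖x‖ ^ 2 ≤ x ⬝ᵥ (B t *ᵥ x) := fun t x => by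
    obtain ⟨-, -, -, h⟩ := hatt t
    rcases eq_or_ne x 0 with rfl | hx
    · simp
    have hpos : 0 < ‖x‖ := norm_pos_iff.2 hx
    have := h (‖x‖⁻¹ • x) (by simp [S, norm_smul, hpos.ne'])
    simp only [Matrix.mulVec_smul, smul_dotProduct, dotProduct_smul, smul_eq_mul] at this
    calc m t * ‖x‖ ^ 2 ≤ (‖x‖⁻¹ * (‖x‖⁻¹ * (x ⬝ᵥ (B t *ᵥ x)))) * ‖x‖ ^ 2 := by gcongr
      _ = x ⬝ᵥ (B t *ᵥ x) := by field_simp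
  have hm0 : 0 < m t₀ := by
    obtain ⟨x, hx, h1, -⟩ := hatt t₀
    rw [h1]
    exact h0.dotProduct_mulVec_pos (hSne0 x hx)
  have hmt : 0 < m t := by
    by_contra! hneg
    obtain ⟨s, hs0⟩ : ∃ s, m s = 0 := mem_range_of_exists_le_of_exists_ge hm ⟨t, hneg⟩ ⟨t₀, hm0.le⟩
    obtain ⟨x, hx, h1, -⟩ := hatt s
    have hpsd : (B s).PosSemidef := Matrix.PosSemidef.of_dotProduct_mulVec_nonneg (hherm s)
      fun y => by simpa [hs0] using hscale s y
    have hker := (hpsd.dotProduct_mulVec_zero_iff x).1 (by simpa [hs0] using h1.symm)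
    exact hSne0 x hx (Matrix.eq_zero_of_mulVec_eq_zero (hdet s) hker)
  refine Matrix.PosDef.of_dotProduct_mulVec_pos (hherm t) fun x hx => ?_
  have hpos : 0 < ‖x‖ := norm_pos_iff.2 hx
  exact lt_of_lt_of_le (by positivity) (hscale t x)

namespace IsGeodesic

variable {n : ℕ} {A : ℝ → Matrix (Fin n) (Fin n) ℝ}

theorem hasDerivAt (h : IsGeodesic A) (t : ℝ) : HasDerivAt A (deriv A t) t :=
  (h.1 t).hasDerivAt

theorem isUnit_det (h : IsGeodesic A) (t : ℝ) : IsUnit (A t).det := by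
  simp [h.2.2.1 t]

/-- The Lagrange multiplier in the geodesic equation. -/
def multiplier (A : ℝ → Matrix (Fin n) (Fin n) ℝ) (t : ℝ) : ℝ :=
  Matrix.trace (deriv A t * (A t)⁻¹ * deriv A t * (A t)⁻¹) /
    Matrix.trace ((A t)⁻¹ * ((A t)⁻¹)ᵀ)

theorem hasDerivAt_deriv (h : IsGeodesic A) (t : ℝ) :
    HasDerivAt (deriv A) (multiplier A t • ((A t)⁻¹)ᵀ) t :=
  (h.2.1 t).hasDerivAt.congr_deriv (h.2.2.2 t)

theorem trace_inv_mul_transpose_pos [NeZero n] (h : IsGeodesic A) (t : ℝ) :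
    0 < ((A t)⁻¹ * ((A t)⁻¹)ᵀ).trace := by
  refine Matrix.trace_mul_self_transpose_pos fun h0 => ?_
  have := Matrix.mul_nonsing_inv _ (h.isUnit_det t)
  rw [h0, Matrix.mul_zero] at this
  exact zero_ne_one this

theorem continuous_inv (h : IsGeodesic A) : Continuous fun t => (A t)⁻¹ :=
  continuous_iff_continuousAt.2 fun t =>
    ((h.hasDerivAt t).matrix_inv_apply h.2.2.1).continuousAt

theorem continuous_deriv (h : IsGeodesic A) : Continuous (deriv A) :=
  continuous_iff_continuousAt.2 fun t => (h.2.1 t).continuousAt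

theorem continuous_multiplier [NeZero n] (h : IsGeodesic A) : Continuous (multiplier A) := by
  have h1 := h.continuous_inv
  have h2 := h.continuous_deriv
  refine Continuous.div ?_ ?_ fun t => (h.trace_inv_mul_transpose_pos t).ne'
  · exact (((h2.matrix_mul h1).matrix_mul h2).matrix_mul h1).matrix_trace
  · exact (h1.matrix_mul h1.matrix_transpose).matrix_trace

theorem trace_inv_mul_deriv [NeZero n] (h : IsGeodesic A)
    (h0 : ((A 0)⁻¹ * deriv A 0).trace = 0) (t : ℝ) : ((A t)⁻¹ * deriv A t).trace = 0 := by
  have hd : ∀ t, HasDerivAt (fun t => ((A t)⁻¹ * deriv A t).trace) 0 t := fun t => by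
    refine ((((h.hasDerivAt t).matrix_inv_apply h.2.2.1).matrix_mul_apply
      (h.hasDerivAt_deriv t)).matrix_trace_apply).congr_deriv (Eq.symm ?_)
    rw [Matrix.mul_smul, Matrix.trace_add, Matrix.trace_smul, smul_eq_mul, multiplier,
      div_mul_cancel₀ _ (h.trace_inv_mul_transpose_pos t).ne', Matrix.neg_mul, Matrix.trace_neg,
      Matrix.mul_assoc, Matrix.mul_assoc, Matrix.trace_mul_comm]
    simp [Matrix.mul_assoc]
  rw [← h0]
  exact is_const_of_deriv_eq_zero (fun t => (hd t).differentiableAt) (fun t => (hd t).deriv) t 0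

/-- Conservation of energy. -/
theorem trace_deriv_mul_transpose [NeZero n] (h : IsGeodesic A)
    (h0 : ((A 0)⁻¹ * deriv A 0).trace = 0) (t : ℝ) :
    (deriv A t * (deriv A t)ᵀ).trace = (deriv A 0 * (deriv A 0)ᵀ).trace := by
  have hd : ∀ t, HasDerivAt (fun t => (deriv A t * (deriv A t)ᵀ).trace) 0 t := fun t => by
    refine (((h.hasDerivAt_deriv t).matrix_mul_apply
      (h.hasDerivAt_deriv t).matrix_transpose_apply).matrix_trace_apply).congr_deriv (Eq.symm ?_)
    have h1 := h.trace_inv_mul_deriv h0 t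
    have h2 : (((A t)⁻¹)ᵀ * (deriv A t)ᵀ).trace = 0 := by
      rw [← Matrix.transpose_mul, Matrix.trace_transpose, Matrix.trace_mul_comm, h1]
    have h3 : (deriv A t * (A t)⁻¹).trace = 0 := by rw [Matrix.trace_mul_comm, h1]
    simp [Matrix.trace_add, h2, h3]
  exact is_const_of_deriv_eq_zero (fun t => (hd t).differentiableAt) (fun t => (hd t).deriv) t 0

theorem deriv_ne_zero [NeZero n] (h : IsGeodesic A) (h0 : ((A 0)⁻¹ * deriv A 0).trace = 0)
    (hne : deriv A 0 ≠ 0) (t : ℝ) : deriv A t ≠ 0 := fun ht => by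
  have h1 := h.trace_deriv_mul_transpose h0 t
  have h2 := Matrix.trace_mul_self_transpose_pos hne
  rw [← h1, ht] at h2
  simp at h2

theorem transpose_mul_deriv_symm (h : IsGeodesic A)
    (h0 : ((A 0)ᵀ * deriv A 0)ᵀ = (A 0)ᵀ * deriv A 0) (t : ℝ) :
    ((A t)ᵀ * deriv A t)ᵀ = (A t)ᵀ * deriv A t := by
  have hd : ∀ t, HasDerivAt (fun t => ((A t)ᵀ * deriv A t)ᵀ - (A t)ᵀ * deriv A t) 0 t := fun t => by
    have h1 := (h.hasDerivAt t).matrix_transpose_apply.matrix_mul_apply (h.hasDerivAt_deriv t)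
    refine (h1.matrix_transpose_apply.sub h1).congr_deriv (Eq.symm ?_)
    have h2 : (A t)ᵀ * ((A t)⁻¹)ᵀ = 1 := by
      rw [← Matrix.transpose_mul, Matrix.nonsing_inv_mul _ (h.isUnit_det t), Matrix.transpose_one]
    rw [Matrix.mul_smul, h2]
    simp [Matrix.transpose_mul]
  have := is_const_of_deriv_eq_zero (fun t => (hd t).differentiableAt) (fun t => (hd t).deriv) t 0
  simp only [h0, sub_self] at this
  exact sub_eq_zero.1 this

theorem deriv_mul_transpose_symm (h : IsGeodesic A)
    (h0 : (deriv A 0 * (A 0)ᵀ)ᵀ = deriv A 0 * (A 0)ᵀ) (t : ℝ) :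
    (deriv A t * (A t)ᵀ)ᵀ = deriv A t * (A t)ᵀ := by
  have hd : ∀ t, HasDerivAt (fun t => (deriv A t * (A t)ᵀ)ᵀ - deriv A t * (A t)ᵀ) 0 t := fun t => by
    have h1 := (h.hasDerivAt_deriv t).matrix_mul_apply (h.hasDerivAt t).matrix_transpose_apply
    refine (h1.matrix_transpose_apply.sub h1).congr_deriv (Eq.symm ?_)
    have h2 : ((A t)⁻¹)ᵀ * (A t)ᵀ = 1 := by
      rw [← Matrix.transpose_mul, Matrix.mul_nonsing_inv _ (h.isUnit_det t), Matrix.transpose_one]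
    rw [Matrix.smul_mul, h2]
    simp [Matrix.transpose_mul]
  have := is_const_of_deriv_eq_zero (fun t => (hd t).differentiableAt) (fun t => (hd t).deriv) t 0
  simp only [h0, sub_self] at this
  exact sub_eq_zero.1 this

/-- If `Oᵀ * A` and its derivative are symmetric at time `0`, then `Oᵀ * A` stays symmetric. -/
theorem transpose_mul_symm [NeZero n] (h : IsGeodesic A) {O : Matrix (Fin n) (Fin n) ℝ}
    (hO : Oᵀ * O = 1) (h0 : (Oᵀ * A 0)ᵀ = Oᵀ * A 0)
    (h1 : (Oᵀ * deriv A 0)ᵀ = Oᵀ * deriv A 0) (t : ℝ) : (Oᵀ * A t)ᵀ = Oᵀ * A t := by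
  have hX : ∀ t, HasDerivAt (fun t => Oᵀ * A t - (Oᵀ * A t)ᵀ)
      (Oᵀ * deriv A t - (Oᵀ * deriv A t)ᵀ) t := fun t => by
    have := (h.hasDerivAt t).matrix_const_mul_apply Oᵀ
    exact this.sub this.matrix_transpose_apply
  have hY : ∀ t, HasDerivAt (fun t => Oᵀ * deriv A t - (Oᵀ * deriv A t)ᵀ)
      (multiplier A t • ((Oᵀ * ((A t)⁻¹)ᵀ) * (Oᵀ * A t - (Oᵀ * A t)ᵀ) * ((A t)⁻¹ * O))) t :=
      fun t => by
    have := (h.hasDerivAt_deriv t).matrix_const_mul_apply Oᵀ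
    refine (this.sub this.matrix_transpose_apply).congr_deriv (Eq.symm ?_)
    have e1 : A t * ((A t)⁻¹ * O) = O := by
      rw [← Matrix.mul_assoc, Matrix.mul_nonsing_inv _ (h.isUnit_det t), Matrix.one_mul]
    have e2 : ((A t)⁻¹)ᵀ * ((A t)ᵀ * (O * ((A t)⁻¹ * O))) = O * ((A t)⁻¹ * O) := by
      rw [← Matrix.mul_assoc, ← Matrix.transpose_mul, Matrix.mul_nonsing_inv _ (h.isUnit_det t),
        Matrix.transpose_one, Matrix.one_mul]
    have e3 : Oᵀ * (O * ((A t)⁻¹ * O)) = (A t)⁻¹ * O := by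
      rw [← Matrix.mul_assoc, hO, Matrix.one_mul]
    simp only [Matrix.mul_sub, Matrix.sub_mul, Matrix.transpose_mul, Matrix.transpose_transpose,
      Matrix.mul_assoc, e1, e2, e3, hO, Matrix.mul_one, Matrix.mul_smul, Matrix.transpose_smul,
      smul_sub]
  have hinv := h.continuous_inv
  have hP : Continuous fun t => Oᵀ * ((A t)⁻¹)ᵀ := continuous_const.matrix_mul hinv.matrix_transpose
  have hQ : Continuous fun t => (A t)⁻¹ * O := hinv.matrix_mul continuous_const
  refine (sub_eq_zero.1 (eq_zero_of_norm_deriv_deriv_le hX hY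
    (K := fun t => |multiplier A t| * (n * (n * ‖Oᵀ * ((A t)⁻¹)ᵀ‖) * ‖(A t)⁻¹ * O‖))
    ?_ (fun t => ?_) (by rw [h0, sub_self]) (by rw [h1, sub_self]) t)).symm
  · exact h.continuous_multiplier.abs.mul
      ((continuous_const.mul (continuous_const.mul hP.norm)).mul hQ.norm)
  · rw [norm_smul, Real.norm_eq_abs, mul_assoc |multiplier A t|]
    refine mul_le_mul_of_nonneg_left ?_ (abs_nonneg _)
    refine (Matrix.norm_mul_le_card_mul _ _).trans ?_
    calc _ ≤ n * (n * ‖Oᵀ * ((A t)⁻¹)ᵀ‖ * ‖Oᵀ * A t - (Oᵀ * A t)ᵀ‖) * ‖(A t)⁻¹ * O‖ := by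
          gcongr
          exact Matrix.norm_mul_le_card_mul _ _
      _ = _ := by ring

/-- The symmetric (polar) case: positivity of the second fundamental form term. -/
theorem trace_pos_of_polar [NeZero n] (h : IsGeodesic A)
    (htan : ((A 0)⁻¹ * deriv A 0).trace = 0) (hne : deriv A 0 ≠ 0)
    {O P : Matrix (Fin n) (Fin n) ℝ} (hO : Oᵀ * O = 1) (hP : P.PosDef) (hA : A 0 = O * P)
    (hs : (Oᵀ * deriv A 0)ᵀ = Oᵀ * deriv A 0) (t : ℝ) :
    0 < (deriv A t * (A t)⁻¹ * deriv A t * (A t)⁻¹).trace := by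
  have hO' : O * Oᵀ = 1 := mul_eq_one_comm.1 hO
  have hOA : Oᵀ * A 0 = P := by rw [hA, ← Matrix.mul_assoc, hO, Matrix.one_mul]
  have hPs : Pᵀ = P := by
    simpa [Matrix.IsHermitian, Matrix.conjTranspose_eq_transpose_of_trivial] using hP.isHermitian
  have hsymm := h.transpose_mul_symm hO (by rw [hOA, hPs]) hs
  have hd : ∀ t, HasDerivAt (fun t => Oᵀ * A t) (Oᵀ * deriv A t) t := fun t =>
    (h.hasDerivAt t).matrix_const_mul_apply Oᵀ
  have hsymm' : (Oᵀ * deriv A t)ᵀ = Oᵀ * deriv A t := by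
    refine HasDerivAt.unique (hd t).matrix_transpose_apply ?_
    simp only [hsymm]
    exact hd t
  have hdetO : (Oᵀ).det ≠ 0 := fun h0 => by
    have := congrArg Matrix.det hO
    simp [Matrix.det_mul, h0] at this
  have hpd := Matrix.posDef_of_continuous_of_det_ne_zero
    (continuous_iff_continuousAt.2 fun t => (hd t).continuousAt) hsymm
    (fun t => by rw [Matrix.det_mul, h.2.2.1 t, mul_one]; exact hdetO) (t₀ := 0) (by rwa [hOA]) t
  have hne' : Oᵀ * deriv A t ≠ 0 := fun h0 => h.deriv_ne_zero htan hne t <| by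
    rw [← Matrix.one_mul (deriv A t), ← hO', Matrix.mul_assoc, h0, Matrix.mul_zero]
  have hpos := hpd.trace_mul_inv_mul_mul_inv_pos hne' hsymm'
  have hOinv : (Oᵀ)⁻¹ = O := Matrix.inv_eq_right_inv hO
  rw [Matrix.mul_inv_rev, hOinv] at hpos
  have e : Oᵀ * deriv A t * ((A t)⁻¹ * O) * (Oᵀ * deriv A t) * ((A t)⁻¹ * O) =
      Oᵀ * (deriv A t * (A t)⁻¹ * (O * Oᵀ) * deriv A t * (A t)⁻¹ * O) := by
    simp only [Matrix.mul_assoc]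
  rwa [e, Matrix.trace_mul_comm, hO', Matrix.mul_one, Matrix.mul_assoc _ O, hO',
    Matrix.mul_one] at hpos

theorem trace_pos_of_transpose_mul_symm [NeZero n] (h : IsGeodesic A)
    (htan : ((A 0)⁻¹ * deriv A 0).trace = 0) (hne : deriv A 0 ≠ 0)
    (hs : ((A 0)ᵀ * deriv A 0)ᵀ = (A 0)ᵀ * deriv A 0) (t : ℝ) :
    0 < (deriv A t * (A t)⁻¹ * deriv A t * (A t)⁻¹).trace := by
  have h1 : ((A t)⁻¹)ᵀ * (A t)ᵀ = 1 := by
    rw [← Matrix.transpose_mul, Matrix.mul_nonsing_inv _ (h.isUnit_det t), Matrix.transpose_one]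
  have e : deriv A t * (A t)⁻¹ = ((A t)⁻¹)ᵀ * ((A t)ᵀ * deriv A t) * (A t)⁻¹ := by
    rw [← Matrix.mul_assoc, h1, Matrix.one_mul]
  have hsymm : (deriv A t * (A t)⁻¹)ᵀ = deriv A t * (A t)⁻¹ := by
    rw [e, Matrix.transpose_mul, Matrix.transpose_mul, h.transpose_mul_deriv_symm hs t,
      Matrix.transpose_transpose]
    simp only [Matrix.mul_assoc]
  have hne' : deriv A t * (A t)⁻¹ ≠ 0 := fun h0 => h.deriv_ne_zero htan hne t <| by
    rw [← Matrix.nonsing_inv_mul_cancel_right _ (deriv A t) (h.isUnit_det t), h0, Matrix.zero_mul]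
  simpa [Matrix.mul_assoc] using Matrix.trace_mul_self_pos_of_symm hne' hsymm

theorem trace_pos_of_mul_transpose_symm [NeZero n] (h : IsGeodesic A)
    (htan : ((A 0)⁻¹ * deriv A 0).trace = 0) (hne : deriv A 0 ≠ 0)
    (hs : (deriv A 0 * (A 0)ᵀ)ᵀ = deriv A 0 * (A 0)ᵀ) (t : ℝ) :
    0 < (deriv A t * (A t)⁻¹ * deriv A t * (A t)⁻¹).trace := by
  have h1 : (A t)ᵀ * ((A t)⁻¹)ᵀ = 1 := by
    rw [← Matrix.transpose_mul, Matrix.nonsing_inv_mul _ (h.isUnit_det t), Matrix.transpose_one]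
  have e : (A t)⁻¹ * deriv A t = (A t)⁻¹ * (deriv A t * (A t)ᵀ) * ((A t)⁻¹)ᵀ := by
    rw [Matrix.mul_assoc, Matrix.mul_assoc, h1, Matrix.mul_one]
  have hsymm : ((A t)⁻¹ * deriv A t)ᵀ = (A t)⁻¹ * deriv A t := by
    rw [e, Matrix.transpose_mul, Matrix.transpose_mul, h.deriv_mul_transpose_symm hs t,
      Matrix.transpose_transpose]
    simp only [Matrix.mul_assoc]
  have hne' : (A t)⁻¹ * deriv A t ≠ 0 := fun h0 => h.deriv_ne_zero htan hne t <| by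
    rw [← Matrix.mul_nonsing_inv_cancel_left _ (deriv A t) (h.isUnit_det t), h0, Matrix.mul_zero]
  have := Matrix.trace_mul_self_pos_of_symm hne' hsymm
  rwa [← Matrix.mul_assoc, Matrix.mul_assoc _ _ (deriv A t), Matrix.mul_assoc (A t)⁻¹,
    Matrix.trace_mul_comm, ← Matrix.mul_assoc] at this

theorem hasDerivAt_trace_mul_transpose (h : IsGeodesic A) (t : ℝ) :
    HasDerivAt (fun t => (A t * (A t)ᵀ).trace) (2 * (deriv A t * (A t)ᵀ).trace) t := by
  refine (((h.hasDerivAt t).matrix_mul_apply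
    (h.hasDerivAt t).matrix_transpose_apply).matrix_trace_apply).congr_deriv (Eq.symm ?_)
  have : (A t * (deriv A t)ᵀ).trace = (deriv A t * (A t)ᵀ).trace := by
    rw [← Matrix.trace_transpose, Matrix.transpose_mul, Matrix.transpose_transpose]
  rw [Matrix.trace_add, this, two_mul]

theorem hasDerivAt_trace_deriv_mul_transpose (h : IsGeodesic A) (t : ℝ) :
    HasDerivAt (fun t => 2 * (deriv A t * (A t)ᵀ).trace)
      (2 * (n * multiplier A t + (deriv A t * (deriv A t)ᵀ).trace)) t := by
  refine ((((h.hasDerivAt_deriv t).matrix_mul_apply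
    (h.hasDerivAt t).matrix_transpose_apply).matrix_trace_apply).const_mul 2).congr_deriv (Eq.symm ?_)
  have h2 : ((A t)⁻¹)ᵀ * (A t)ᵀ = 1 := by
    rw [← Matrix.transpose_mul, Matrix.mul_nonsing_inv _ (h.isUnit_det t), Matrix.transpose_one]
  rw [Matrix.trace_add, Matrix.smul_mul, h2, Matrix.trace_smul, Matrix.trace_one,
    Fintype.card_fin, smul_eq_mul, mul_comm (n : ℝ)]

end IsGeodesic

/-- sufficient conditions for unboundedness. If the initial data
`(A₀, A₁)` of a geodesic satisfies one of the three symmetry conditions, then the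
second fundamental form term stays positive for all time and `‖A(t)‖ → ∞` as
`t → ±∞`. -/
theorem statement_9 {n : ℕ} (A₀ A₁ : Matrix (Fin n) (Fin n) ℝ)
    (hdet : A₀.det = 1) (hne : A₁ ≠ 0)
    (htan : Matrix.trace (A₀⁻¹ * A₁) = 0)
    (hcase :
      (∃ O P : Matrix (Fin n) (Fin n) ℝ, Oᵀ * O = 1 ∧ O.det = 1 ∧ Pᵀ = P ∧
        (∀ x : Fin n → ℝ, x ≠ 0 → 0 < x ⬝ᵥ P.mulVec x) ∧ A₀ = O * P ∧
        (Oᵀ * A₁)ᵀ = Oᵀ * A₁) ∨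
      (A₀ᵀ * A₁)ᵀ = A₀ᵀ * A₁ ∨
      (A₁ * A₀ᵀ)ᵀ = A₁ * A₀ᵀ)
    (A : ℝ → Matrix (Fin n) (Fin n) ℝ) (hgeo : IsGeodesic A)
    (hA0 : A 0 = A₀) (hA1 : deriv A 0 = A₁) :
    (∀ t : ℝ, 0 < Matrix.trace (deriv A t * (A t)⁻¹ * deriv A t * (A t)⁻¹)) ∧
    Tendsto (fun t => hsNorm (A t)) atTop atTop ∧
    Tendsto (fun t => hsNorm (A t)) atBot atTop := by
  have hn : NeZero n := ⟨fun h => hne (by subst h; exact Subsingleton.elim _ _)⟩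
  subst hA0 hA1
  have hpos : ∀ t : ℝ, 0 < Matrix.trace (deriv A t * (A t)⁻¹ * deriv A t * (A t)⁻¹) := by
    rcases hcase with ⟨O, P, hO, -, hPs, hP, hA, hs⟩ | hs | hs
    · have hPd : P.PosDef := Matrix.PosDef.of_dotProduct_mulVec_pos
        (by rw [Matrix.IsHermitian, Matrix.conjTranspose_eq_transpose_of_trivial, hPs])
        fun x hx => by simpa using hP x hx
      exact hgeo.trace_pos_of_polar htan hne hO hPd hA hs
    · exact hgeo.trace_pos_of_transpose_mul_symm htan hne hs
    · exact hgeo.trace_pos_of_mul_transpose_symm htan hne hs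
  have hE : 0 < 2 * (deriv A 0 * (deriv A 0)ᵀ).trace :=
    mul_pos two_pos (Matrix.trace_mul_self_transpose_pos hne)
  have hconv : ∀ t, 2 * (deriv A 0 * (deriv A 0)ᵀ).trace ≤
      2 * (n * IsGeodesic.multiplier A t + (deriv A t * (deriv A t)ᵀ).trace) := fun t => by
    rw [hgeo.trace_deriv_mul_transpose htan t]
    have : 0 ≤ IsGeodesic.multiplier A t :=
      div_nonneg (hpos t).le (hgeo.trace_inv_mul_transpose_pos t).le
    have : 0 ≤ n * IsGeodesic.multiplier A t := by positivity
    linarith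
  refine ⟨hpos, ?_, ?_⟩
  · exact Real.tendsto_sqrt_atTop.comp (tendsto_atTop_of_le_deriv_deriv hE
      hgeo.hasDerivAt_trace_mul_transpose hgeo.hasDerivAt_trace_deriv_mul_transpose hconv)
  · exact Real.tendsto_sqrt_atTop.comp (tendsto_atBot_of_le_deriv_deriv hE
      hgeo.hasDerivAt_trace_mul_transpose hgeo.hasDerivAt_trace_deriv_mul_transpose hconv)
end
end

section
/- Let A₀, A₁ ∈ M_n(ℝ). Then det(A₀ + t·A₁) = 1 for all t ∈ ℝ if and only if det A₀ = 1 and A₀⁻¹·A₁ is nilpotent. Equivalently, a straight line t ↦ A₀ + t·A₁ in M_n(ℝ) lies entirely in SL(n) if and only if it can be written as t ↦ B·(I + t·M) with B ∈ SL(n) and M nilpotent. -/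
noncomputable section
open Matrix

open Polynomial in
/-- A square matrix over an infinite field is nilpotent iff `det (1 + t M) = 1` for all `t`. -/
theorem isNilpotent_iff_forall_det_one_add_smul {ι K : Type*} [Fintype ι] [DecidableEq ι]
    [Field K] [Infinite K] (M : Matrix ι ι K) :
    IsNilpotent M ↔ ∀ t : K, (1 + t • M).det = 1 := by
  constructor
  · intro hM t
    obtain ⟨c, -, hc⟩ := Polynomial.isUnit_iff.mp (isUnit_charpolyRev_of_isNilpotent hM)
    have hc1 : c = 1 := by simpa [← hc] using eval_charpolyRev (M := M)
    have heval : eval (-t) M.charpolyRev = (1 + t • M).det := by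
      rw [charpolyRev, ← coe_evalRingHom, RingHom.map_det]
      congr 1
      ext i j
      simp [Matrix.one_apply, apply_ite, mul_comm t]
    rw [← heval, ← hc, hc1, eval_C]
  · intro h
    have hchar : M.charpoly = X ^ Fintype.card ι := by
      refine eq_of_infinite_eval_eq _ _ ((Set.finite_singleton (0 : K)).infinite_compl.mono ?_)
      intro c (hc : c ≠ 0)
      have hfactor : scalar ι c - M = c • (1 + (-c⁻¹) • M) := by
        rw [smul_add, smul_smul, mul_neg, mul_inv_cancel₀ hc, neg_one_smul, ← sub_eq_add_neg,
          scalar_apply, smul_one_eq_diagonal]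
      change eval c M.charpoly = eval c (X ^ Fintype.card ι)
      rw [eval_charpoly, hfactor, det_smul, h, mul_one, eval_pow, eval_X]
    exact ⟨Fintype.card ι, by simpa [hchar] using aeval_self_charpoly M⟩

/-- a straight line `t ↦ A₀ + t·A₁` in `Mₙ(ℝ)` lies entirely in
`SL(n)` if and only if `det A₀ = 1` and `A₀⁻¹·A₁` is nilpotent. -/
theorem statement_11 {n : ℕ} (A₀ A₁ : Matrix (Fin n) (Fin n) ℝ) :
    (∀ t : ℝ, (A₀ + t • A₁).det = 1) ↔
      (A₀.det = 1 ∧ ∃ k : ℕ, 0 < k ∧ (A₀⁻¹ * A₁) ^ k = 0) := by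
  have hline (h₀ : A₀.det = 1) (t : ℝ) : (A₀ + t • A₁).det = (1 + t • (A₀⁻¹ * A₁)).det := by
    have hfactor : A₀ + t • A₁ = A₀ * (1 + t • (A₀⁻¹ * A₁)) := by
      rw [mul_add, mul_one, mul_smul_comm, mul_nonsing_inv_cancel_left _ _ (by simp [h₀])]
    rw [hfactor, det_mul, h₀, one_mul]
  constructor
  · intro h
    have h₀ : A₀.det = 1 := by simpa using h 0
    obtain ⟨k, hk⟩ := (isNilpotent_iff_forall_det_one_add_smul (A₀⁻¹ * A₁)).mpr
      fun t => (hline h₀ t).symm.trans (h t)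
    exact ⟨h₀, k + 1, k.succ_pos, by rw [pow_succ, hk, zero_mul]⟩
  · rintro ⟨h₀, k, -, hk⟩ t
    rw [hline h₀, (isNilpotent_iff_forall_det_one_add_smul _).mp ⟨k, hk⟩]
end
end

section
/- Along linear geodesics there are no conjugate points: let B ∈ SL(n), let M be a nilpotent n×n real matrix, and let A(t) = B·(I + t·M). If J is a Jacobi field along A that is not identically zero, then the set {t ∈ ℝ : J(t) = 0} contains at most one element. -/
noncomputable section
open Matrix Filter

attribute [local instance] Matrix.normedAddCommGroup Matrix.normedSpace

/-- A Jacobi field along a linear geodesic `A` of `SL(n)`: a twice differentiable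
matrix-valued map `J` that is tangent to `SL(n)` along `A` (`tr(A⁻¹J) = 0`) and
whose second derivative is everywhere a scalar multiple of `(A⁻¹)ᵀ`. -/
def IsJacobiField {n : ℕ} (A J : ℝ → Matrix (Fin n) (Fin n) ℝ) : Prop :=
  (∀ t, DifferentiableAt ℝ J t) ∧ (∀ t, DifferentiableAt ℝ (deriv J) t) ∧
  (∀ t, Matrix.trace ((A t)⁻¹ * J t) = 0) ∧
  (∀ t, ∃ c : ℝ, deriv (deriv J) t = c • ((A t)⁻¹)ᵀ)

theorem hasDerivAt_trace_mul {n : ℕ} {X Y : ℝ → Matrix (Fin n) (Fin n) ℝ}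
    {X' Y' : Matrix (Fin n) (Fin n) ℝ} {t : ℝ} (hX : HasDerivAt X X' t) (hY : HasDerivAt Y Y' t) :
    HasDerivAt (fun s => trace (X s * Y s)) (trace (X' * Y t) + trace (X t * Y')) t := by
  have hX' : ∀ i j, HasDerivAt (fun s => X s i j) (X' i j) t := fun i j =>
    hasDerivAt_pi.1 (hasDerivAt_pi.1 hX i) j
  have hY' : ∀ i j, HasDerivAt (fun s => Y s i j) (Y' i j) t := fun i j =>
    hasDerivAt_pi.1 (hasDerivAt_pi.1 hY i) j
  simp only [trace, diag_apply, mul_apply, ← Finset.sum_add_distrib]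
  exact HasDerivAt.fun_sum fun i _ => HasDerivAt.fun_sum fun j _ => (hX' i j).mul (hY' j i)

theorem hasDerivAt_matrix_transpose {n : ℕ} {X : ℝ → Matrix (Fin n) (Fin n) ℝ}
    {X' : Matrix (Fin n) (Fin n) ℝ} {t : ℝ} (hX : HasDerivAt X X' t) :
    HasDerivAt (fun s => (X s)ᵀ) X'ᵀ t :=
  hasDerivAt_pi.2 fun i => hasDerivAt_pi.2 fun j => hasDerivAt_pi.1 (hasDerivAt_pi.1 hX j) i

theorem abs_trace_mul_le {n : ℕ} (X Y : Matrix (Fin n) (Fin n) ℝ) :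
    |trace (X * Y)| ≤ (n : ℝ) ^ 2 * ‖X‖ * ‖Y‖ := by
  have h : ∀ i j, |X i j * Y j i| ≤ ‖X‖ * ‖Y‖ := fun i j => by
    rw [abs_mul]
    exact mul_le_mul (norm_entry_le_entrywise_sup_norm X) (norm_entry_le_entrywise_sup_norm Y)
      (abs_nonneg _) (norm_nonneg _)
  simp only [trace, diag_apply, mul_apply]
  calc |∑ i, ∑ j, X i j * Y j i| ≤ ∑ i, ∑ j, |X i j * Y j i| :=
        (Finset.abs_sum_le_sum_abs _ _).trans
          (Finset.sum_le_sum fun i _ => Finset.abs_sum_le_sum_abs _ _)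
    _ ≤ ∑ _i : Fin n, ∑ _j : Fin n, ‖X‖ * ‖Y‖ :=
        Finset.sum_le_sum fun i _ => Finset.sum_le_sum fun j _ => h i j
    _ = (n : ℝ) ^ 2 * ‖X‖ * ‖Y‖ := by simp; ring

theorem trace_mul_transpose_self_nonneg {n : ℕ} (X : Matrix (Fin n) (Fin n) ℝ) :
    0 ≤ trace (X * Xᵀ) := by
  simp only [trace, diag_apply, mul_apply, transpose_apply]
  exact Finset.sum_nonneg fun i _ => Finset.sum_nonneg fun j _ => mul_self_nonneg _

theorem trace_mul_transpose_self_eq_zero {n : ℕ} {X : Matrix (Fin n) (Fin n) ℝ}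
    (h : trace (X * Xᵀ) = 0) : X = 0 := by
  rw [← conjTranspose_eq_transpose_of_trivial] at h
  exact trace_mul_conjTranspose_self_eq_zero_iff.1 h

/-- Forward uniqueness for the zero solution of a second order linear differential inequality. -/
theorem eq_zero_of_norm_second_deriv_le_of_le {E : Type*} [NormedAddCommGroup E] [NormedSpace ℝ E]
    {J J' J'' : ℝ → E} {K : ℝ → ℝ} (hJ : ∀ t, HasDerivAt J (J' t) t)
    (hJ' : ∀ t, HasDerivAt J' (J'' t) t) (hK : Continuous K)
    (hbound : ∀ t, ‖J'' t‖ ≤ K t * ‖(J t, J' t)‖) {a : ℝ} (h0 : J a = 0) (h0' : J' a = 0)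
    {b : ℝ} (hab : a ≤ b) : J b = 0 := by
  obtain ⟨C, hC⟩ := isCompact_Icc.bddAbove_image (hK.continuousOn (s := Set.Icc a b))
  have hd : ∀ t, HasDerivAt (fun t => (J t, J' t)) (J' t, J'' t) t := fun t =>
    (hJ t).prodMk (hJ' t)
  have key := norm_le_gronwallBound_of_norm_deriv_right_le (f := fun t => (J t, J' t))
    (f' := fun t => (J' t, J'' t)) (δ := 0) (K := max 1 C) (ε := 0) (a := a) (b := b)
    (fun t _ => (hd t).continuousAt.continuousWithinAt) (fun t _ => (hd t).hasDerivWithinAt)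
    (by simp [h0, h0']) (fun t ht => ?_) b ⟨hab, le_rfl⟩
  · simp only [gronwallBound_ε0_δ0] at key
    exact norm_le_zero_iff.1 ((norm_fst_le (J b, J' b)).trans key)
  · rw [add_zero, Prod.norm_def (J' t, J'' t)]
    refine max_le ?_ ?_
    · calc ‖J' t‖ ≤ 1 * ‖(J t, J' t)‖ := by rw [one_mul]; exact norm_snd_le (J t, J' t)
        _ ≤ _ := by gcongr; exact le_max_left _ _
    · refine (hbound t).trans ?_
      gcongr
      exact (hC ⟨t, ⟨ht.1, ht.2.le⟩, rfl⟩).trans (le_max_right _ _)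

theorem eq_zero_of_norm_second_deriv_le {E : Type*} [NormedAddCommGroup E] [NormedSpace ℝ E]
    {J J' J'' : ℝ → E} {K : ℝ → ℝ} (hJ : ∀ t, HasDerivAt J (J' t) t)
    (hJ' : ∀ t, HasDerivAt J' (J'' t) t) (hK : Continuous K)
    (hbound : ∀ t, ‖J'' t‖ ≤ K t * ‖(J t, J' t)‖) {a : ℝ} (h0 : J a = 0) (h0' : J' a = 0)
    (b : ℝ) : J b = 0 := by
  rcases le_total a b with hab | hab
  · exact eq_zero_of_norm_second_deriv_le_of_le hJ hJ' hK hbound h0 h0' hab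
  · have key := eq_zero_of_norm_second_deriv_le_of_le (J := fun t => J (-t))
      (J' := fun t => -J' (-t)) (J'' := fun t => J'' (-t)) (K := fun t => K (-t))
      (a := -a) (b := -b)
      (fun t => by simpa [Function.comp_def] using (hJ (-t)).scomp t (hasDerivAt_neg t))
      (fun t => by
        simpa [Function.comp_def] using ((hJ' (-t)).scomp t (hasDerivAt_neg t)).fun_neg)
      (hK.comp continuous_neg)
      (fun t => by simpa [Prod.norm_def] using hbound (-t)) (by simpa using h0)
      (by simpa using h0') (neg_le_neg hab)
    simpa using key

/-- The inverse of a linear geodesic of `SL(n)` is polynomial in the parameter. -/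
theorem exists_contDiff_inv_linear_geodesic {n : ℕ} (B M : Matrix (Fin n) (Fin n) ℝ)
    (hB : B.det = 1) (hM : IsNilpotent M) :
    ∃ Q : ℝ → Matrix (Fin n) (Fin n) ℝ, ContDiff ℝ 2 Q ∧
      (∀ t, (B * (1 + t • M))⁻¹ = Q t) ∧ ∀ t, B * (1 + t • M) * Q t = 1 := by
  obtain ⟨k, hk⟩ := hM
  have hBu : IsUnit B.det := by simp [hB]
  have hinv : ∀ t : ℝ,
      B * (1 + t • M) * ∑ i ∈ Finset.range k, (-t) ^ i • (M ^ i * B⁻¹) = 1 := fun t => by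
    have hgeom : (1 + t • M) * ∑ i ∈ Finset.range k, (-(t • M)) ^ i = 1 := by
      have h := mul_neg_geom_sum (-(t • M)) k
      rwa [sub_neg_eq_add, ← neg_smul, smul_pow, hk, smul_zero, sub_zero, neg_smul] at h
    have hsum : ∑ i ∈ Finset.range k, (-t) ^ i • (M ^ i * B⁻¹) =
        (∑ i ∈ Finset.range k, (-(t • M)) ^ i) * B⁻¹ := by
      rw [Finset.sum_mul]
      refine Finset.sum_congr rfl fun i _ => ?_
      rw [← neg_smul, smul_pow, smul_mul_assoc]
    rw [hsum, Matrix.mul_assoc, ← Matrix.mul_assoc (1 + t • M), hgeom, Matrix.one_mul,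
      mul_nonsing_inv _ hBu]
  exact ⟨fun t => ∑ i ∈ Finset.range k, (-t) ^ i • (M ^ i * B⁻¹), by fun_prop,
    fun t => inv_eq_right_inv (hinv t), hinv⟩

/-- A Jacobi field satisfies a second order linear differential inequality. -/
theorem exists_continuous_norm_second_deriv_le {n : ℕ} {Q J J' J'' : ℝ → Matrix (Fin n) (Fin n) ℝ}
    (hQ : ContDiff ℝ 2 Q) (hQ0 : ∀ t, Q t ≠ 0) (hJ : ∀ t, HasDerivAt J (J' t) t)
    (hJ' : ∀ t, HasDerivAt J' (J'' t) t) (htr : ∀ t, trace (Q t * J t) = 0)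
    (hacc : ∀ t, ∃ c : ℝ, J'' t = c • (Q t)ᵀ) :
    ∃ K : ℝ → ℝ, Continuous K ∧ ∀ t, ‖J'' t‖ ≤ K t * ‖(J t, J' t)‖ := by
  have hQd : ∀ t, HasDerivAt Q (deriv Q t) t := fun t =>
    (hQ.differentiable (by norm_num) t).hasDerivAt
  have hQ1 : ContDiff ℝ 1 (deriv Q) := (contDiff_succ_iff_deriv (n := 1).1 hQ).2.2
  have hQdd : ∀ t, HasDerivAt (deriv Q) (deriv (deriv Q) t) t := fun t =>
    (hQ1.differentiable (by norm_num) t).hasDerivAt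
  have hQc2 : Continuous (deriv (deriv Q)) := hQ1.continuous_deriv le_rfl
  have hQc1 : Continuous (deriv Q) := hQ1.continuous
  have hQc : Continuous Q := hQ.continuous
  have htr1 : ∀ t, trace (deriv Q t * J t) + trace (Q t * J' t) = 0 := fun t => by
    have h := hasDerivAt_trace_mul (hQd t) (hJ t)
    simp only [htr] at h
    exact h.unique (hasDerivAt_const t 0)
  have htr2 : ∀ t, trace (deriv (deriv Q) t * J t) + 2 * trace (deriv Q t * J' t)
      + trace (Q t * J'' t) = 0 := fun t => by
    have h := (hasDerivAt_trace_mul (hQdd t) (hJ t)).fun_add (hasDerivAt_trace_mul (hQd t) (hJ' t))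
    simp only [htr1] at h
    linarith [h.unique (hasDerivAt_const t 0)]
  have hpos : ∀ t, 0 < trace (Q t * (Q t)ᵀ) := fun t =>
    (trace_mul_transpose_self_nonneg _).lt_of_ne fun h =>
      hQ0 t (trace_mul_transpose_self_eq_zero h.symm)
  refine ⟨fun t => (n : ℝ) ^ 2 * (‖deriv (deriv Q) t‖ + 2 * ‖deriv Q t‖) / trace (Q t * (Q t)ᵀ)
    * ‖(Q t)ᵀ‖, ?_, fun t => ?_⟩
  · have hden : Continuous fun t => trace (Q t * (Q t)ᵀ) :=
      (hQc.matrix_mul hQc.matrix_transpose).matrix_trace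
    exact ((continuous_const.mul (hQc2.norm.add (continuous_const.mul hQc1.norm))).div hden
      fun t => (hpos t).ne').mul hQc.matrix_transpose.norm
  · obtain ⟨c, hc⟩ := hacc t
    have h2 := htr2 t
    rw [hc, Matrix.mul_smul, trace_smul, smul_eq_mul] at h2
    have hcle : |c| * trace (Q t * (Q t)ᵀ) ≤
        (n : ℝ) ^ 2 * (‖deriv (deriv Q) t‖ + 2 * ‖deriv Q t‖) * ‖(J t, J' t)‖ := by
      rw [← abs_of_pos (hpos t), ← abs_mul]
      have e : c * trace (Q t * (Q t)ᵀ) =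
          -(trace (deriv (deriv Q) t * J t) + 2 * trace (deriv Q t * J' t)) := by linarith
      rw [e, abs_neg]
      calc _ ≤ |trace (deriv (deriv Q) t * J t)| + 2 * |trace (deriv Q t * J' t)| := by
            refine (abs_add_le _ _).trans_eq ?_
            rw [abs_mul, abs_two]
        _ ≤ (n : ℝ) ^ 2 * ‖deriv (deriv Q) t‖ * ‖(J t, J' t)‖
            + 2 * ((n : ℝ) ^ 2 * ‖deriv Q t‖ * ‖(J t, J' t)‖) := by
          gcongr
          · refine (abs_trace_mul_le _ _).trans ?_
            gcongr
            exact norm_fst_le (J t, J' t)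
          · refine (abs_trace_mul_le _ _).trans ?_
            gcongr
            exact norm_snd_le (J t, J' t)
        _ = _ := by ring
    rw [hc, norm_smul, Real.norm_eq_abs, mul_right_comm, div_mul_eq_mul_div]
    gcongr
    exact (le_div_iff₀ (hpos t)).2 hcle

/-- If a curve is orthogonal to its acceleration and vanishes twice, then it and its velocity
vanish simultaneously somewhere. -/
theorem exists_eq_zero_and_deriv_eq_zero {n : ℕ} {J J' J'' : ℝ → Matrix (Fin n) (Fin n) ℝ}
    (hJ : ∀ t, HasDerivAt J (J' t) t) (hJ' : ∀ t, HasDerivAt J' (J'' t) t)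
    (horth : ∀ t, trace (J'' t * (J t)ᵀ) = 0) {a b : ℝ} (hab : a < b) (ha : J a = 0)
    (hb : J b = 0) : ∃ t, J t = 0 ∧ J' t = 0 := by
  have hd : ∀ t, HasDerivAt (fun s => trace (J' s * (J s)ᵀ)) (trace (J' t * (J' t)ᵀ)) t :=
    fun t => by
      simpa only [horth, zero_add] using
        hasDerivAt_trace_mul (hJ' t) (hasDerivAt_matrix_transpose (hJ t))
  have hmono : Monotone fun s => trace (J' s * (J s)ᵀ) :=
    monotone_of_hasDerivAt_nonneg hd fun t => trace_mul_transpose_self_nonneg _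
  have hzero : ∀ t ∈ Set.Icc a b, trace (J' t * (J t)ᵀ) = 0 := fun t ht => by
    have h1 := hmono ht.1
    have h2 := hmono ht.2
    simp only [ha, hb, transpose_zero, Matrix.mul_zero, trace_zero] at h1 h2
    exact le_antisymm h2 h1
  have hderiv : ∀ t ∈ Set.Ioo a b, J' t = 0 := fun t ht => by
    have h : (fun s => trace (J' s * (J s)ᵀ)) =ᶠ[nhds t] fun _ => 0 := by
      filter_upwards [Icc_mem_nhds ht.1 ht.2] with s hs using hzero s hs
    exact trace_mul_transpose_self_eq_zero
      ((hd t).unique ((hasDerivAt_const t (0 : ℝ)).congr_of_eventuallyEq h))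
  have hda : J' a = 0 := by
    refine tendsto_nhds_unique_of_eventuallyEq
      ((hJ' a).continuousAt.tendsto.mono_left nhdsWithin_le_nhds) tendsto_const_nhds
      (f := J') (l := nhdsWithin a (Set.Ioi a)) ?_
    filter_upwards [Ioo_mem_nhdsGT hab] with s hs using hderiv s hs
  exact ⟨a, ha, hda⟩

/-- along linear geodesics `A(t) = B(I + tM)` (with `B ∈ SL(n)` and
`M` nilpotent) there are no conjugate points: a not-identically-zero Jacobi field
vanishes at most once. -/
theorem statement_12 {n : ℕ} (B M : Matrix (Fin n) (Fin n) ℝ)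
    (hB : B.det = 1) (hM : ∃ k : ℕ, 0 < k ∧ M ^ k = 0)
    (J : ℝ → Matrix (Fin n) (Fin n) ℝ)
    (hJ : IsJacobiField (fun t => B * (1 + t • M)) J)
    (hJne : ∃ t : ℝ, J t ≠ 0) :
    {t : ℝ | J t = 0}.Subsingleton := by
  obtain ⟨hd, hdd, htr, hacc⟩ := hJ
  obtain ⟨t₀, ht₀⟩ := hJne
  obtain ⟨k, -, hk⟩ := hM
  obtain ⟨Q, hQ, hQinv, hQmul⟩ := exists_contDiff_inv_linear_geodesic B M hB ⟨k, hk⟩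
  simp only [hQinv] at htr hacc
  have hQ0 : ∀ t, Q t ≠ 0 := fun t h => ht₀ <| by
    have h1 := hQmul t
    rw [h, Matrix.mul_zero] at h1
    rw [← Matrix.one_mul (J t₀), ← h1, Matrix.zero_mul]
  have hJd : ∀ t, HasDerivAt J (deriv J t) t := fun t => (hd t).hasDerivAt
  have hJdd : ∀ t, HasDerivAt (deriv J) (deriv (deriv J) t) t := fun t => (hdd t).hasDerivAt
  have horth : ∀ t, trace (deriv (deriv J) t * (J t)ᵀ) = 0 := fun t => by
    obtain ⟨c, hc⟩ := hacc t
    rw [hc, Matrix.smul_mul, trace_smul, ← transpose_mul, trace_transpose, trace_mul_comm, htr,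
      smul_zero]
  obtain ⟨K, hK, hbound⟩ := exists_continuous_norm_second_deriv_le hQ hQ0 hJd hJdd htr hacc
  have hne : ∀ a b, a < b → J a = 0 → J b = 0 → False := fun a b hab ha hb => by
    obtain ⟨t, h0, h0'⟩ := exists_eq_zero_and_deriv_eq_zero hJd hJdd horth hab ha hb
    exact ht₀ (eq_zero_of_norm_second_deriv_le hJd hJdd hK hbound h0 h0' t₀)
  intro a ha b hb
  rcases lt_trichotomy a b with h | h | h
  · exact (hne a b h ha hb).elim
  · exact h
  · exact (hne b a h hb ha).elim
end
end

section
/- Let B ∈ SL(n), let M be a nilpotent n×n real matrix, let A(t) = B·(I + t·M), and let J be a Jacobi field along A. Then there exists a constant C > 0 such that for all t ∈ ℝ: ‖J(t)‖ ≤ C·(1 + |t|), and the covariant derivative of J along A is bounded: ‖J'(t) − (⟨J'(t), (A(t)⁻¹)ᵀ⟩ / ‖A(t)⁻¹‖²)·(A(t)⁻¹)ᵀ‖ ≤ C. -/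
noncomputable section
open Matrix Filter

attribute [local instance] Matrix.normedAddCommGroup Matrix.normedSpace

/-- If `‖f''(t)‖ ≤ K (‖f(t)‖ / t ^ 3 + ‖f'(t)‖ / t ^ 2)` for large `t`, then `f'` is bounded
near `+∞`. -/
theorem norm_deriv_bounded_of_norm_deriv_two_le {E : Type*} [NormedAddCommGroup E]
    [NormedSpace ℝ E] {f f' f'' : ℝ → E} {K T₀ : ℝ} (hK : 0 ≤ K)
    (hf : ∀ t, HasDerivAt f (f' t) t) (hf' : ∀ t, HasDerivAt f' (f'' t) t)
    (hbound : ∀ t ≥ T₀, ‖f'' t‖ ≤ K * (‖f t‖ / t ^ 3 + ‖f' t‖ / t ^ 2)) :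
    ∃ T C : ℝ, ∀ t ≥ T, ‖f' t‖ ≤ C := by
  set T := max T₀ (4 * K + 1)
  have hT0 : T₀ ≤ T := le_max_left _ _
  have hTK : 4 * K + 1 ≤ T := le_max_right _ _
  have hTpos : 0 < T := by linarith
  refine ⟨T, 2 * ‖f' T‖ + ‖f T‖ / 2, fun s hs => ?_⟩
  have hcont : Continuous f' := continuous_iff_continuousAt.2 fun t => (hf' t).continuousAt
  obtain ⟨r, hr, hmax⟩ := isCompact_Icc.exists_isMaxOn (Set.nonempty_Icc.2 hs)
    hcont.norm.continuousOn
  set m := ‖f' r‖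
  have hle : ∀ t ∈ Set.Icc T s, ‖f' t‖ ≤ m := fun t ht => hmax ht
  have hm0 : 0 ≤ m := norm_nonneg _
  have hf_le : ∀ t ∈ Set.Icc T s, ‖f t‖ ≤ (‖f T‖ + m) * t := by
    intro t ht
    have h1 := norm_image_sub_le_of_norm_deriv_le_segment' (f := f) (f' := f') (a := T) (b := s)
      (fun x _ => (hf x).hasDerivWithinAt) (fun x hx => hle x ⟨hx.1, hx.2.le⟩) t ht
    have h2 := norm_le_norm_add_norm_sub' (f t) (f T)
    have h3 : 1 ≤ t := by linarith [ht.1]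
    nlinarith [norm_nonneg (f T), mul_nonneg hm0 hTpos.le,
      mul_nonneg (norm_nonneg (f T)) (sub_nonneg.2 h3)]
  set D := K * (‖f T‖ + 2 * m) with hD
  have hf''_le : ∀ t ∈ Set.Icc T s, ‖f'' t‖ ≤ D / t ^ 2 := by
    intro t ht
    have htpos : 0 < t := by linarith [ht.1]
    calc ‖f'' t‖ ≤ K * (‖f t‖ / t ^ 3 + ‖f' t‖ / t ^ 2) := hbound t (hT0.trans ht.1)
      _ ≤ K * ((‖f T‖ + m) * t / t ^ 3 + m / t ^ 2) := by
        gcongr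
        · exact hf_le t ht
        · exact hle t ht
      _ = D / t ^ 2 := by rw [hD]; field_simp; ring
  have key := image_norm_le_of_norm_deriv_right_le_deriv_boundary' (f := fun t => f' t - f' T)
    (f' := f'') (a := T) (b := s) (B := fun t => D * (T⁻¹ - t⁻¹)) (B' := fun t => D / t ^ 2)
    (by fun_prop) (fun x _ => ((hf' x).sub_const _).hasDerivWithinAt) (by simp)
    (fun x hx => by
      have : x ≠ 0 := by linarith [hx.1]
      fun_prop (disch := assumption))
    (fun x hx => by
      have hx0 : x ≠ 0 := by linarith [hx.1]
      have := (((hasDerivAt_inv hx0).const_sub T⁻¹).const_mul D).hasDerivWithinAt (s := Set.Ici x)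
      rwa [neg_neg, ← div_eq_mul_inv] at this)
    (fun x hx => hf''_le x ⟨hx.1, hx.2.le⟩) hr
  have hrpos : 0 < r := by linarith [hr.1]
  have hDT : D * (T⁻¹ - r⁻¹) ≤ (‖f T‖ + 2 * m) / 4 := by
    have h1 : K * T⁻¹ ≤ 1 / 4 := by
      rw [← div_eq_mul_inv, div_le_iff₀ hTpos]; linarith
    have h2 : D * (T⁻¹ - r⁻¹) ≤ D * T⁻¹ := by
      apply mul_le_mul_of_nonneg_left _ (by positivity)
      linarith [inv_pos.2 hrpos]
    have h3 : D * T⁻¹ = (K * T⁻¹) * (‖f T‖ + 2 * m) := by rw [hD]; ring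
    have h4 : 0 ≤ ‖f T‖ + 2 * m := by positivity
    nlinarith
  have h5 := norm_le_norm_add_norm_sub' (f' r) (f' T)
  have h6 := hle s ⟨hs, le_rfl⟩
  linarith

/-- Let `V(t) = Q(1/t)` with `Q` smooth and `Q(0) ≠ 0`. If `J(t)` is orthogonal to `V(t)` and
`J''(t)` is parallel to `V(t)` for `t > 0`, then `J'` is bounded near `+∞`. -/
theorem norm_deriv_bounded_of_orthogonal_of_parallel {E : Type*} [NormedAddCommGroup E]
    [NormedSpace ℝ E] (b : E →ₗ[ℝ] E →ₗ[ℝ] ℝ) {C₀ : ℝ}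
    (hb : ∀ x y, ‖b x y‖ ≤ C₀ * ‖x‖ * ‖y‖) (hb' : ∀ x, ‖x‖ ^ 2 ≤ b x x)
    {Q Q' Q'' : ℝ → E} (hQ : ∀ s, HasDerivAt Q (Q' s) s) (hQ' : ∀ s, HasDerivAt Q' (Q'' s) s)
    (hQ'' : Continuous Q'') (hQ0 : Q 0 ≠ 0) {J J' J'' : ℝ → E}
    (hJ : ∀ t, HasDerivAt J (J' t) t) (hJ' : ∀ t, HasDerivAt J' (J'' t) t)
    (horth : ∀ t > 0, b (Q t⁻¹) (J t) = 0) (hpar : ∀ t > 0, ∃ c : ℝ, J'' t = c • Q t⁻¹) :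
    ∃ T C : ℝ, ∀ t ≥ T, ‖J' t‖ ≤ C := by
  set β := b.mkContinuous₂ C₀ hb
  have hβ : ∀ x, ‖x‖ ^ 2 ≤ β x x := hb'
  have hQc : Continuous Q := continuous_iff_continuousAt.2 fun t => (hQ t).continuousAt
  have hQc' : Continuous Q' := continuous_iff_continuousAt.2 fun t => (hQ' t).continuousAt
  obtain ⟨L₁, hL₁⟩ := isCompact_Icc.exists_bound_of_continuousOn (s := Set.Icc (0 : ℝ) 1)
    hQc'.continuousOn
  obtain ⟨L₂, hL₂⟩ := isCompact_Icc.exists_bound_of_continuousOn (s := Set.Icc (0 : ℝ) 1)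
    hQ''.continuousOn
  have hL₁0 : 0 ≤ L₁ := (norm_nonneg _).trans (hL₁ 0 (by simp))
  have hL₂0 : 0 ≤ L₂ := (norm_nonneg _).trans (hL₂ 0 (by simp))
  set δ := ‖Q 0‖ / 2
  have hδ0 : 0 < δ := half_pos (norm_pos_iff.2 hQ0)
  have hlow : ∀ᶠ t : ℝ in atTop, δ < ‖Q t⁻¹‖ := by
    have : Tendsto (fun t : ℝ => ‖Q t⁻¹‖) atTop (nhds ‖Q 0‖) :=
      (hQc.norm.tendsto 0).comp tendsto_inv_atTop_zero
    exact this.eventually_const_lt (half_lt_self (norm_pos_iff.2 hQ0))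
  obtain ⟨T₁, hT₁⟩ := eventually_atTop.1 hlow
  set V : ℝ → E := fun t => Q t⁻¹
  set V' : ℝ → E := fun t => (-(t ^ 2)⁻¹) • Q' t⁻¹
  set V'' : ℝ → E := fun t => (-(t ^ 2)⁻¹) • ((-(t ^ 2)⁻¹) • Q'' t⁻¹) + (2 / t ^ 3) • Q' t⁻¹
  have hV : ∀ t > 0, HasDerivAt V (V' t) t := fun t ht =>
    (hQ t⁻¹).scomp t (hasDerivAt_inv ht.ne')
  have hV' : ∀ t > 0, HasDerivAt V' (V'' t) t := by
    intro t ht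
    have h1 : HasDerivAt (fun t : ℝ => -(t ^ 2)⁻¹) (2 / t ^ 3) t := by
      have h := ((hasDerivAt_pow 2 t).inv (pow_ne_zero 2 ht.ne')).neg
      have heq : -(-(((2 : ℕ) : ℝ) * t ^ (2 - 1)) / (t ^ 2) ^ 2) = 2 / t ^ 3 := by
        norm_num
        field_simp
      rwa [heq] at h
    exact h1.smul ((hQ' t⁻¹).scomp t (hasDerivAt_inv ht.ne'))
  have hzero : ∀ {g : ℝ → ℝ} {g' : ℝ} {t : ℝ}, 0 < t → (∀ t > 0, g t = 0) →
      HasDerivAt g g' t → g' = 0 := by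
    intro g g' t ht h0 hg
    refine hg.unique ((hasDerivAt_const t (0 : ℝ)).congr_of_eventuallyEq ?_)
    filter_upwards [lt_mem_nhds ht] with x hx using h0 x hx
  have h₁ : ∀ t > 0, β (V t) (J' t) + β (V' t) (J t) = 0 := fun t ht =>
    hzero ht horth (β.hasDerivAt_of_bilinear (fun _ => hV t ht) (fun _ => hJ t))
  have h₂ : ∀ t > 0,
      (β (V t) (J'' t) + β (V' t) (J' t)) + (β (V' t) (J' t) + β (V'' t) (J t)) = 0 :=
    fun t ht => hzero ht h₁
      ((β.hasDerivAt_of_bilinear (fun _ => hV t ht) (fun _ => hJ' t)).add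
        (β.hasDerivAt_of_bilinear (fun _ => hV' t ht) (fun _ => hJ t)))
  refine norm_deriv_bounded_of_norm_deriv_two_le (K := ‖β‖ * (L₂ + 2 * L₁) / δ)
    (T₀ := max T₁ 1) (by positivity) hJ hJ' fun t ht => ?_
  have ht1 : 1 ≤ t := (le_max_right _ _).trans ht
  have ht0 : 0 < t := by linarith
  have hδV : δ < ‖V t‖ := hT₁ t ((le_max_left _ _).trans ht)
  have hmem : t⁻¹ ∈ Set.Icc (0 : ℝ) 1 := ⟨by positivity, inv_le_one_of_one_le₀ ht1⟩
  have hV'_le : ‖V' t‖ ≤ L₁ / t ^ 2 := by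
    have := hL₁ _ hmem
    simp only [V', norm_smul, norm_neg, norm_inv, norm_pow, Real.norm_of_nonneg ht0.le]
    rw [div_eq_inv_mul]
    gcongr
  have hV''_le : ‖V'' t‖ ≤ (L₂ + 2 * L₁) / t ^ 3 := by
    have h1 := hL₁ _ hmem
    have h2 := hL₂ _ hmem
    calc ‖V'' t‖ ≤ (t ^ 2)⁻¹ * ((t ^ 2)⁻¹ * ‖Q'' t⁻¹‖) + 2 / t ^ 3 * ‖Q' t⁻¹‖ := by
          refine (norm_add_le _ _).trans (le_of_eq ?_)
          simp only [norm_smul, norm_neg, norm_inv, norm_div, norm_pow,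
            Real.norm_of_nonneg ht0.le, Real.norm_ofNat]
      _ ≤ (t ^ 2)⁻¹ * (t⁻¹ * L₂) + 2 / t ^ 3 * L₁ := by
          gcongr
          exact le_self_pow₀ ht1 two_ne_zero
      _ = (L₂ + 2 * L₁) / t ^ 3 := by field_simp
  obtain ⟨c, hc⟩ := hpar t ht0
  have hVpos : 0 < ‖V t‖ := hδ0.trans hδV
  have hcV : |c| * ‖V t‖ ^ 2 ≤ ‖β‖ * ‖V'' t‖ * ‖J t‖ + 2 * (‖β‖ * ‖V' t‖ * ‖J' t‖) := by
    have hcoe : β (V t) (J'' t) = c * β (V t) (V t) := by rw [hc, map_smul, smul_eq_mul]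
    have heq : c * β (V t) (V t) = -(β (V'' t) (J t)) - 2 * β (V' t) (J' t) := by
      linarith [h₂ t ht0]
    calc |c| * ‖V t‖ ^ 2 ≤ |c| * |β (V t) (V t)| := by
          gcongr
          exact (hβ _).trans (le_abs_self _)
      _ = |-(β (V'' t) (J t)) - 2 * β (V' t) (J' t)| := by rw [← abs_mul, heq]
      _ ≤ |β (V'' t) (J t)| + 2 * |β (V' t) (J' t)| := by
          refine (abs_sub _ _).trans (le_of_eq ?_)
          rw [abs_neg, abs_mul, abs_two]
      _ ≤ _ := by
          gcongr
          · exact β.le_opNorm₂ _ _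
          · exact β.le_opNorm₂ _ _
  have hnorm : ‖J'' t‖ = |c| * ‖V t‖ := by rw [hc, norm_smul, Real.norm_eq_abs]
  have hmul : δ * ‖J'' t‖ ≤ ‖β‖ * ‖V'' t‖ * ‖J t‖ + 2 * (‖β‖ * ‖V' t‖ * ‖J' t‖) := by
    refine le_trans ?_ hcV
    rw [hnorm, sq]
    nlinarith [mul_nonneg (abs_nonneg c) hVpos.le]
  calc ‖J'' t‖ ≤ (‖β‖ * ‖V'' t‖ * ‖J t‖ + 2 * (‖β‖ * ‖V' t‖ * ‖J' t‖)) / δ := by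
        rw [le_div_iff₀ hδ0]; linarith
    _ ≤ (‖β‖ * ((L₂ + 2 * L₁) / t ^ 3) * ‖J t‖
          + ‖β‖ * ((L₂ + 2 * L₁) / t ^ 2) * ‖J' t‖) / δ := by
        have : 2 * (‖β‖ * ‖V' t‖ * ‖J' t‖) ≤ ‖β‖ * ((L₂ + 2 * L₁) / t ^ 2) * ‖J' t‖ := by
          have h1 : 2 * ‖V' t‖ ≤ (L₂ + 2 * L₁) / t ^ 2 := by
            have : 2 * (L₁ / t ^ 2) ≤ (L₂ + 2 * L₁) / t ^ 2 := by
              rw [← mul_div_assoc]; gcongr; linarith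
            linarith
          calc 2 * (‖β‖ * ‖V' t‖ * ‖J' t‖) = ‖β‖ * (2 * ‖V' t‖) * ‖J' t‖ := by ring
            _ ≤ _ := by gcongr
        gcongr
    _ = ‖β‖ * (L₂ + 2 * L₁) / δ * (‖J t‖ / t ^ 3 + ‖J' t‖ / t ^ 2) := by field_simp

theorem hsInner_eq_sum {n : ℕ} (X Y : Matrix (Fin n) (Fin n) ℝ) :
    hsInner X Y = ∑ i, ∑ j, X i j * Y i j := by
  simp [hsInner, Matrix.trace, Matrix.mul_apply]

/-- The Hilbert–Schmidt inner product as a bilinear form. -/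
def hsInnerₗ (n : ℕ) :
    Matrix (Fin n) (Fin n) ℝ →ₗ[ℝ] Matrix (Fin n) (Fin n) ℝ →ₗ[ℝ] ℝ :=
  LinearMap.mk₂ ℝ hsInner
    (fun X X' Y => by simp only [hsInner, add_mul, Matrix.trace_add])
    (fun c X Y => by simp only [hsInner, Matrix.smul_mul, Matrix.trace_smul])
    (fun X Y Y' => by simp only [hsInner, Matrix.transpose_add, mul_add, Matrix.trace_add])
    (fun c X Y => by
      simp only [hsInner, Matrix.transpose_smul, Matrix.mul_smul, Matrix.trace_smul])

theorem hsInnerₗ_apply {n : ℕ} (X Y : Matrix (Fin n) (Fin n) ℝ) :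
    hsInnerₗ n X Y = hsInner X Y := rfl

theorem norm_hsInner_le {n : ℕ} (X Y : Matrix (Fin n) (Fin n) ℝ) :
    ‖hsInner X Y‖ ≤ (n : ℝ) ^ 2 * ‖X‖ * ‖Y‖ := by
  rw [hsInner_eq_sum]
  calc ‖∑ i, ∑ j, X i j * Y i j‖ ≤ ∑ _i : Fin n, ∑ _j : Fin n, ‖X‖ * ‖Y‖ := by
        refine norm_sum_le_of_le _ fun i _ => norm_sum_le_of_le _ fun j _ => ?_
        rw [norm_mul]
        exact mul_le_mul (norm_entry_le_entrywise_sup_norm X)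
          (norm_entry_le_entrywise_sup_norm Y) (norm_nonneg _) (norm_nonneg _)
    _ = (n : ℝ) ^ 2 * ‖X‖ * ‖Y‖ := by
        simp only [Finset.sum_const, Finset.card_univ, Fintype.card_fin, nsmul_eq_mul]
        ring

theorem hsInner_self_nonneg {n : ℕ} (X : Matrix (Fin n) (Fin n) ℝ) : 0 ≤ hsInner X X := by
  rw [hsInner_eq_sum]
  exact Finset.sum_nonneg fun i _ => Finset.sum_nonneg fun j _ => mul_self_nonneg _

theorem hsNorm_eq_sqrt {n : ℕ} (X : Matrix (Fin n) (Fin n) ℝ) :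
    hsNorm X = Real.sqrt (hsInner X X) := rfl

theorem sq_norm_le_hsInner_self {n : ℕ} (X : Matrix (Fin n) (Fin n) ℝ) :
    ‖X‖ ^ 2 ≤ hsInner X X := by
  refine (Real.le_sqrt (norm_nonneg _) (hsInner_self_nonneg X)).1 ?_
  refine (Matrix.norm_le_iff (Real.sqrt_nonneg _)).2 fun i j => Real.le_sqrt_of_sq_le ?_
  rw [hsInner_eq_sum, Real.norm_eq_abs, sq_abs, sq]
  refine le_trans ?_ (Finset.single_le_sum (f := fun i => ∑ j, X i j * X i j)
    (fun i _ => Finset.sum_nonneg fun j _ => mul_self_nonneg _) (Finset.mem_univ i))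
  exact Finset.single_le_sum (f := fun j => X i j * X i j)
    (fun j _ => mul_self_nonneg _) (Finset.mem_univ j)

theorem hsNorm_le {n : ℕ} (X : Matrix (Fin n) (Fin n) ℝ) :
    hsNorm X ≤ n * ‖X‖ := by
  rw [hsNorm_eq_sqrt]
  refine Real.sqrt_le_iff.2 ⟨by positivity, ?_⟩
  rw [mul_pow, sq ‖X‖, ← mul_assoc]
  exact (le_abs_self _).trans (norm_hsInner_le X X)

/-- Subtracting the orthogonal projection onto a line does not increase the norm. -/
theorem hsNorm_sub_proj_le {n : ℕ} (X Y : Matrix (Fin n) (Fin n) ℝ) :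
    hsNorm (X - (hsInner X Yᵀ / hsNorm Y ^ 2) • Yᵀ) ≤ hsNorm X := by
  have hY : hsNorm Y ^ 2 = hsInner Yᵀ Yᵀ := by
    rw [hsNorm_eq_sqrt, Real.sq_sqrt (hsInner_self_nonneg Y), hsInner, hsInner,
      Matrix.transpose_transpose, Matrix.trace_mul_comm]
  have hcomm : hsInner Yᵀ X = hsInner X Yᵀ := by
    simp only [hsInner_eq_sum, mul_comm]
  rw [hY, hsNorm_eq_sqrt, hsNorm_eq_sqrt]
  refine Real.sqrt_le_sqrt ?_
  set a := hsInner X Yᵀ / hsInner Yᵀ Yᵀ with ha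
  have hexp : hsInner (X - a • Yᵀ) (X - a • Yᵀ)
      = hsInner X X - 2 * a * hsInner X Yᵀ + a * (a * hsInner Yᵀ Yᵀ) := by
    simp only [← hsInnerₗ_apply, map_sub, map_smul, LinearMap.sub_apply,
      LinearMap.smul_apply, smul_eq_mul] at hcomm ⊢
    rw [hcomm]; ring
  rw [hexp]
  rcases eq_or_ne (hsInner Yᵀ Yᵀ) 0 with h0 | h0
  · simp [ha, h0]
  · have h1 : a * hsInner Yᵀ Yᵀ = hsInner X Yᵀ := div_mul_cancel₀ _ h0
    have h2 : 0 ≤ a * hsInner X Yᵀ := by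
      rw [← h1, ← mul_assoc]
      exact mul_nonneg (mul_self_nonneg a) (hsInner_self_nonneg _)
    rw [h1]; linarith

/-- Along a linear geodesic, `t ^ (-d) (A(t)⁻¹)ᵀ` is a smooth function of `1/t` not vanishing
at `0`, where `d + 1` is the nilpotency index. -/
theorem exists_inv_transpose_eq_smul {n : ℕ} [Nontrivial (Matrix (Fin n) (Fin n) ℝ)]
    (B M : Matrix (Fin n) (Fin n) ℝ) (hB : B.det = 1) (hM : IsNilpotent M) :
    ∃ (d : ℕ) (Q : ℝ → Matrix (Fin n) (Fin n) ℝ), ContDiff ℝ 2 Q ∧ Q 0 ≠ 0 ∧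
      ∀ t ≠ 0, ((B * (1 + t • M))⁻¹)ᵀ = t ^ d • Q t⁻¹ := by
  obtain ⟨d, hd⟩ : ∃ d, nilpotencyClass M = d + 1 :=
    Nat.exists_eq_succ_of_ne_zero (pos_nilpotencyClass_iff.2 hM).ne'
  have hd0 : M ^ d ≠ 0 := by
    have := pow_pred_nilpotencyClass hM
    rwa [hd, Nat.add_sub_cancel] at this
  have hd1 : M ^ (d + 1) = 0 := hd ▸ pow_nilpotencyClass hM
  have hBu : IsUnit B.det := by rw [hB]; exact isUnit_one
  refine ⟨d, fun s => ∑ i ∈ Finset.range (d + 1), s ^ (d - i) • ((-1 : ℝ) ^ i • (M ^ i * B⁻¹)ᵀ),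
    by fun_prop, ?_, fun t ht => ?_⟩
  · simp only
    rw [Finset.sum_eq_single_of_mem d (Finset.self_mem_range_succ d)]
    · intro h
      have h1 : (M ^ d * B⁻¹)ᵀ = 0 := by
        rw [Nat.sub_self, pow_zero, one_smul] at h
        exact (smul_eq_zero.1 h).resolve_left (pow_ne_zero _ (by norm_num))
      have h2 : M ^ d * B⁻¹ = 0 := Matrix.transpose_eq_zero.1 h1
      apply hd0
      rw [← Matrix.nonsing_inv_mul_cancel_right B (M ^ d) hBu, h2, zero_mul]
    · intro i hi hid
      have : d - i ≠ 0 := by have := Finset.mem_range.1 hi; omega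
      simp [this]
  · have hinv : (B * (1 + t • M))⁻¹ = (∑ i ∈ Finset.range (d + 1), (-(t • M)) ^ i) * B⁻¹ := by
      refine Matrix.inv_eq_left_inv ?_
      rw [Matrix.mul_assoc, Matrix.nonsing_inv_mul_cancel_left B _ hBu]
      have := geom_sum_mul_neg (-(t • M)) (d + 1)
      rw [neg_pow, smul_pow, hd1, smul_zero, mul_zero, sub_zero, sub_neg_eq_add] at this
      exact this
    rw [hinv, Finset.sum_mul, Matrix.transpose_sum, Finset.smul_sum]
    refine Finset.sum_congr rfl fun i hi => ?_
    have hid : i ≤ d := Nat.lt_succ_iff.1 (Finset.mem_range.1 hi)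
    have htt : t ^ d * t⁻¹ ^ (d - i) = t ^ i := by
      rw [inv_pow, ← div_eq_mul_inv, div_eq_iff (pow_ne_zero _ ht), ← pow_add,
        Nat.add_sub_cancel' hid]
    have hneg : -(t • M) = (-1 * t) • M := by rw [neg_one_mul, neg_smul]
    rw [smul_smul, smul_smul, htt, hneg, smul_pow, mul_pow, Matrix.smul_mul,
      Matrix.transpose_smul, mul_comm]

theorem hsInner_transpose_left {n : ℕ} (X Y : Matrix (Fin n) (Fin n) ℝ) :
    hsInner Xᵀ Y = Matrix.trace (X * Y) := by
  rw [hsInner, ← Matrix.transpose_mul, Matrix.trace_transpose, Matrix.trace_mul_comm]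

/-- The derivative of a Jacobi field along a linear geodesic is bounded for positive times. -/
theorem IsJacobiField.norm_deriv_bounded_of_nonneg {n : ℕ} {B M : Matrix (Fin n) (Fin n) ℝ}
    (hB : B.det = 1) (hM : IsNilpotent M) {J : ℝ → Matrix (Fin n) (Fin n) ℝ}
    (hJ : IsJacobiField (fun t => B * (1 + t • M)) J) :
    ∃ C : ℝ, ∀ t ≥ 0, ‖deriv J t‖ ≤ C := by
  rcases subsingleton_or_nontrivial (Matrix (Fin n) (Fin n) ℝ) with h | h
  · exact ⟨0, fun t _ => by rw [Subsingleton.elim (deriv J t) 0, norm_zero]⟩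
  obtain ⟨hJ1, hJ2, horth, hpar⟩ := hJ
  obtain ⟨d, Q, hQ, hQ0, hQA⟩ := exists_inv_transpose_eq_smul B M hB hM
  have hQ1 : ContDiff ℝ 1 (deriv Q) := hQ.deriv'
  obtain ⟨T, C, hC⟩ := norm_deriv_bounded_of_orthogonal_of_parallel (hsInnerₗ n)
    norm_hsInner_le sq_norm_le_hsInner_self
    (fun s => (hQ.differentiable two_ne_zero s).hasDerivAt)
    (fun s => (hQ1.differentiable one_ne_zero s).hasDerivAt)
    (hQ1.continuous_deriv le_rfl) hQ0
    (fun t => (hJ1 t).hasDerivAt) (fun t => (hJ2 t).hasDerivAt)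
    (fun t ht => by
      have h1 := horth t
      rw [← hsInner_transpose_left, hQA t ht.ne', ← hsInnerₗ_apply, map_smul,
        LinearMap.smul_apply, smul_eq_mul] at h1
      exact (mul_eq_zero.1 h1).resolve_left (pow_ne_zero _ ht.ne'))
    (fun t ht => by
      obtain ⟨c, hc⟩ := hpar t
      exact ⟨c * t ^ d, hc.trans (by rw [hQA t ht.ne', smul_smul])⟩)
  have hcont : Continuous (deriv J) := continuous_iff_continuousAt.2 fun t => (hJ2 t).continuousAt
  obtain ⟨C', hC'⟩ := isCompact_Icc.exists_bound_of_continuousOn (s := Set.Icc 0 T)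
    hcont.continuousOn
  refine ⟨max C C', fun t ht => ?_⟩
  rcases le_total T t with h | h
  · exact (hC t h).trans (le_max_left _ _)
  · exact (hC' t ⟨ht, h⟩).trans (le_max_right _ _)

theorem IsJacobiField.comp_neg {n : ℕ} {A J : ℝ → Matrix (Fin n) (Fin n) ℝ}
    (hJ : IsJacobiField A J) : IsJacobiField (fun t => A (-t)) (fun t => J (-t)) := by
  obtain ⟨hJ1, hJ2, horth, hpar⟩ := hJ
  have hd : deriv (fun t => J (-t)) = fun t => -deriv J (-t) := by
    funext t; exact deriv_comp_neg J t
  have hdd : deriv (fun t => -deriv J (-t)) = fun t => deriv (deriv J) (-t) := by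
    funext t
    have h := ((hJ2 (-t)).hasDerivAt.scomp t (hasDerivAt_neg t)).neg.deriv
    rwa [neg_smul, one_smul, neg_neg] at h
  refine ⟨fun t => (hJ1 (-t)).comp t differentiableAt_id.neg, fun t => ?_, fun t => horth (-t),
    fun t => ?_⟩
  · rw [hd]
    exact ((hJ2 (-t)).comp t differentiableAt_id.neg).neg
  · rw [hd, hdd]
    exact hpar (-t)

/-- along a linear geodesic `A(t) = B(I + tM)`, any Jacobi field
grows at most linearly and its covariant derivative (the tangential part of `J'`)
is bounded. -/
theorem statement_13 {n : ℕ} (B M : Matrix (Fin n) (Fin n) ℝ)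
    (hB : B.det = 1) (hM : ∃ k : ℕ, 0 < k ∧ M ^ k = 0)
    (A : ℝ → Matrix (Fin n) (Fin n) ℝ) (hA : A = fun t => B * (1 + t • M))
    (J : ℝ → Matrix (Fin n) (Fin n) ℝ) (hJ : IsJacobiField A J) :
    ∃ C > (0 : ℝ), ∀ t : ℝ,
      hsNorm (J t) ≤ C * (1 + |t|) ∧
      hsNorm (deriv J t -
        (hsInner (deriv J t) (((A t)⁻¹)ᵀ) / hsNorm ((A t)⁻¹) ^ 2) • ((A t)⁻¹)ᵀ) ≤ C := by
  subst hA
  have hnil : IsNilpotent M := let ⟨k, _, hk⟩ := hM; ⟨k, hk⟩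
  obtain ⟨C₁, hC₁⟩ := hJ.norm_deriv_bounded_of_nonneg hB hnil
  have hJneg : IsJacobiField (fun t => B * (1 + t • -M)) fun t => J (-t) := by
    simpa only [neg_smul, smul_neg] using hJ.comp_neg
  obtain ⟨C₂, hC₂⟩ := hJneg.norm_deriv_bounded_of_nonneg hB hnil.neg
  have hbound : ∀ t, ‖deriv J t‖ ≤ max C₁ C₂ := by
    intro t
    rcases le_total 0 t with ht | ht
    · exact (hC₁ t ht).trans (le_max_left _ _)
    · have := hC₂ (-t) (by linarith)
      have hd : deriv (fun t => J (-t)) (-t) = -deriv J (- -t) := deriv_comp_neg J (-t)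
      rw [hd, norm_neg, neg_neg] at this
      exact this.trans (le_max_right _ _)
  set C := max C₁ C₂
  have hC0 : 0 ≤ C := (norm_nonneg _).trans (hbound 0)
  refine ⟨n * (‖J 0‖ + C) + 1, by positivity, fun t => ⟨?_, ?_⟩⟩
  · have h1 : ‖J t - J 0‖ ≤ C * ‖t - 0‖ :=
      convex_univ.norm_image_sub_le_of_norm_deriv_le (fun x _ => hJ.1 x) (fun x _ => hbound x)
        (Set.mem_univ 0) (Set.mem_univ t)
    rw [sub_zero, Real.norm_eq_abs] at h1
    have h2 := norm_le_norm_add_norm_sub' (J t) (J 0)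
    have h3 : ‖J t‖ ≤ (‖J 0‖ + C) * (1 + |t|) := by
      nlinarith [mul_nonneg (norm_nonneg (J 0)) (abs_nonneg t)]
    calc hsNorm (J t) ≤ n * ((‖J 0‖ + C) * (1 + |t|)) :=
          (hsNorm_le _).trans (mul_le_mul_of_nonneg_left h3 n.cast_nonneg)
      _ ≤ _ := by rw [← mul_assoc]; gcongr; linarith
  · calc _ ≤ hsNorm (deriv J t) := hsNorm_sub_proj_le _ _
      _ ≤ n * ‖deriv J t‖ := hsNorm_le _
      _ ≤ n * (‖J 0‖ + C) := by gcongr; linarith [hbound t, norm_nonneg (J 0)]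
      _ ≤ _ := by linarith
end
end
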